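/- Let W : 𝒳 → 𝒴 be a discrete memoryless channel with finite input alphabet 𝒳 of cardinality 2^q and fixed input distribution P_X, labeled by a bijection f, and consider the multilevel polar construction with block length N = 2^n. Then, as n → ∞: q − lim |𝓛_X|/N = lim |𝓗_X|/N = H(X), and q − lim |𝓛_{X|Y}|/N = lim |𝓗_{X|Y}|/N = H(X|Y), where (X,Y) is distributed as P_X followed by W. -/

import Mathlib

open scoped BigOperators Classical
open Filter Topology

noncomputable section

namespace PolarWiretap

variable {Ω α γ 𝒱 : Type*}

/-- Probability mass assigned by the weight function `p` to the value `a`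
of the random variable `X` (the distribution of `X`). -/
def dist [Fintype Ω] (p : Ω → ℝ) (X : Ω → α) (a : α) : ℝ :=
  ∑ ω, if X ω = a then p ω else 0

/-- Probability of the event `E` under the weight function `p`. -/
def pr [Fintype Ω] (p : Ω → ℝ) (E : Ω → Prop) : ℝ :=
  ∑ ω, if E ω then p ω else 0

/-- Shannon entropy (in bits) of the random variable `X` under `p`. -/
def H [Fintype Ω] [Fintype α] (p : Ω → ℝ) (X : Ω → α) : ℝ :=
  ∑ a, -(dist p X a * Real.logb 2 (dist p X a))

/-- Conditional Shannon entropy `H(X|Y) = H(X,Y) − H(Y)` (in bits). -/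
def condH [Fintype Ω] [Fintype α] [Fintype γ] (p : Ω → ℝ) (X : Ω → α) (Y : Ω → γ) : ℝ :=
  H p (fun ω => (X ω, Y ω)) - H p Y

/-- Mutual information `I(X;Y) = H(X) + H(Y) − H(X,Y)` (in bits). -/
def MI [Fintype Ω] [Fintype α] [Fintype γ] (p : Ω → ℝ) (X : Ω → α) (Y : Ω → γ) : ℝ :=
  H p X + H p Y - H p (fun ω => (X ω, Y ω))

/-- Bhattacharyya parameter
`Z_B(T|V) = 2 ∑_v √(P_{T,V}(0,v) · P_{T,V}(1,v))` of a binary random variable `T`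
given the side information `V`. -/
def ZB [Fintype Ω] [Fintype 𝒱] (p : Ω → ℝ) (T : Ω → ZMod 2) (V : Ω → 𝒱) : ℝ :=
  2 * ∑ v, Real.sqrt (dist p (fun ω => (T ω, V ω)) (0, v) *
      dist p (fun ω => (T ω, V ω)) (1, v))

/-- `p` is a probability mass function on the finite type `Ω`. -/
def IsPMF [Fintype Ω] (p : Ω → ℝ) : Prop := (∀ ω, 0 ≤ p ω) ∧ ∑ ω, p ω = 1

/-- `W` is a (discrete memoryless) channel: a stochastic matrix. -/
def IsChannel {𝒳 𝒴 : Type*} [Fintype 𝒴] (W : 𝒳 → 𝒴 → ℝ) : Prop :=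
  (∀ x y, 0 ≤ W x y) ∧ ∀ x, ∑ y, W x y = 1

/-- `W₂` is degraded with respect to `W₁` (`W₂ ⪯ W₁`): there is a channel `W̃`
with `W₂(z|x) = ∑_y W₁(y|x)·W̃(z|y)`. -/
def Degraded {𝒳 𝒴 𝒵 : Type*} [Fintype 𝒴] [Fintype 𝒵]
    (W₂ : 𝒳 → 𝒵 → ℝ) (W₁ : 𝒳 → 𝒴 → ℝ) : Prop :=
  ∃ Wt : 𝒴 → 𝒵 → ℝ, IsChannel Wt ∧ ∀ x z, W₂ x z = ∑ y, W₁ x y * Wt y z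

/-- The binary entropy function `h₂(x) = −x log₂ x − (1−x) log₂ (1−x)`. -/
def h2 (x : ℝ) : ℝ := -(x * Real.logb 2 x) - (1 - x) * Real.logb 2 (1 - x)

/-- The single-letter joint distribution of an input `X ~ P_X` and the output of
the channel `W` fed with `X`: `P(x,y) = P_X(x)·W(y|x)`. -/
def slP {𝒳 𝒴 : Type*} (PX : 𝒳 → ℝ) (W : 𝒳 → 𝒴 → ℝ) : 𝒳 × 𝒴 → ℝ :=
  fun a => PX a.1 * W a.1 a.2


/-- Entry `(i,j)` of the polar generator matrix `G_N = B_N · G^{⊗n}` over `𝔽₂`,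
where `G = [[1,0],[1,1]]`, `G^{⊗n}` is the `n`-th Kronecker power and `B_N` the
bit-reversal permutation (`N = 2^n`). -/
def GN (n : ℕ) (i j : Fin (2 ^ n)) : ZMod 2 :=
  if ∀ k < n, Nat.testBit j.val k → Nat.testBit i.val (n - 1 - k) then 1 else 0

variable {𝒳 𝒴 𝒵 : Type*}

/-- The i.i.d. distribution `P(x) = ∏_i P_X(x_i)` of `N = 2^n` input symbols. -/
def codeX [Fintype 𝒳] (PX : 𝒳 → ℝ) (n : ℕ) : (Fin (2 ^ n) → 𝒳) → ℝ :=
  fun x => ∏ i, PX (x i)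

/-- The joint distribution of `N = 2^n` i.i.d. inputs `X_i ∼ P_X` together with
the outputs of `N` independent uses of the channel `W`. -/
def codeP [Fintype 𝒳] [Fintype 𝒴] (PX : 𝒳 → ℝ) (W : 𝒳 → 𝒴 → ℝ) (n : ℕ) :
    ((Fin (2 ^ n) → 𝒳) × (Fin (2 ^ n) → 𝒴)) → ℝ :=
  fun ω => (∏ i, PX (ω.1 i)) * ∏ i, W (ω.1 i) (ω.2 i)

/-- The `l`-th label bit `B_j^l` of the `j`-th symbol, via the bit labeling `f`. -/
def Bbit {q : ℕ} (f : (Fin q → ZMod 2) ≃ 𝒳) (n : ℕ) (x : Fin (2 ^ n) → 𝒳)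
    (j : Fin (2 ^ n)) (l : Fin q) : ZMod 2 :=
  f.symm (x j) l

/-- The polar-transformed bit `U_i^l` at level `l`:  `U^l = B^l · G_N`
(recall `G_N` is its own inverse, so this inverts `B^l = U^l · G_N`). -/
def Ubit {q : ℕ} (f : (Fin q → ZMod 2) ≃ 𝒳) (n : ℕ) (x : Fin (2 ^ n) → 𝒳)
    (l : Fin q) (i : Fin (2 ^ n)) : ZMod 2 :=
  ∑ j, Bbit f n x j l * GN n j i

/-- The value space of the side information
`V_i^l = (U^l_{[i−1]}, B^{[l−1]}_{[N]})`. -/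
abbrev VType (q n : ℕ) (l : Fin q) (i : Fin (2 ^ n)) : Type :=
  ({j : Fin (2 ^ n) // j < i} → ZMod 2) × (Fin (2 ^ n) → {k : Fin q // k < l} → ZMod 2)

/-- The side information `V_i^l = (U^l_{[i−1]}, B^{[l−1]}_{[N]})`: the previous
bits of level `l` together with all label bits of the lower levels. -/
def Vval {q : ℕ} (f : (Fin q → ZMod 2) ≃ 𝒳) (n : ℕ) (x : Fin (2 ^ n) → 𝒳)
    (l : Fin q) (i : Fin (2 ^ n)) : VType q n l i :=
  (fun j => Ubit f n x l j.1, fun j k => Bbit f n x j k.1)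

/-- The polarization threshold `δ_N = 2^{−N^β}`, `N = 2^n`. -/
noncomputable def deltaN (β : ℝ) (n : ℕ) : ℝ := (2 : ℝ) ^ (-((2 ^ n : ℝ) ^ β))

/-- The Bhattacharyya parameter `Z_B(U_i^l | V_i^l)` (no channel output). -/
def ZBplain [Fintype 𝒳] {q : ℕ} (PX : 𝒳 → ℝ) (f : (Fin q → ZMod 2) ≃ 𝒳)
    (n : ℕ) (l : Fin q) (i : Fin (2 ^ n)) : ℝ :=
  ZB (codeX PX n) (fun x => Ubit f n x l i) (fun x => Vval f n x l i)

/-- The Bhattacharyya parameter `Z_B(U_i^l | V_i^l, Y)` with the channel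
output vector `Y` of `W` as extra side information. -/
def ZBout [Fintype 𝒳] [Fintype 𝒴] {q : ℕ} (PX : 𝒳 → ℝ) (W : 𝒳 → 𝒴 → ℝ)
    (f : (Fin q → ZMod 2) ≃ 𝒳) (n : ℕ) (l : Fin q) (i : Fin (2 ^ n)) : ℝ :=
  ZB (codeP PX W n) (fun ω => Ubit f n ω.1 l i) (fun ω => (Vval f n ω.1 l i, ω.2))

/-- `𝓛_X = {(l,i) : Z_B(U_i^l | V_i^l) < δ_N}`. -/
def Lplain [Fintype 𝒳] {q : ℕ} (PX : 𝒳 → ℝ) (f : (Fin q → ZMod 2) ≃ 𝒳)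
    (β : ℝ) (n : ℕ) : Set (Fin q × Fin (2 ^ n)) :=
  {a | ZBplain PX f n a.1 a.2 < deltaN β n}

/-- `𝓗_X = {(l,i) : Z_B(U_i^l | V_i^l) > 1 − δ_N}`. -/
def Hplain [Fintype 𝒳] {q : ℕ} (PX : 𝒳 → ℝ) (f : (Fin q → ZMod 2) ≃ 𝒳)
    (β : ℝ) (n : ℕ) : Set (Fin q × Fin (2 ^ n)) :=
  {a | 1 - deltaN β n < ZBplain PX f n a.1 a.2}

/-- `𝓛_{X|Y} = {(l,i) : Z_B(U_i^l | V_i^l, Y) < δ_N}` (for the channel `W`). -/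
def Lout [Fintype 𝒳] [Fintype 𝒴] {q : ℕ} (PX : 𝒳 → ℝ) (W : 𝒳 → 𝒴 → ℝ)
    (f : (Fin q → ZMod 2) ≃ 𝒳) (β : ℝ) (n : ℕ) : Set (Fin q × Fin (2 ^ n)) :=
  {a | ZBout PX W f n a.1 a.2 < deltaN β n}

/-- `𝓗_{X|Y} = {(l,i) : Z_B(U_i^l | V_i^l, Y) > 1 − δ_N}` (for the channel `W`). -/
def Hout [Fintype 𝒳] [Fintype 𝒴] {q : ℕ} (PX : 𝒳 → ℝ) (W : 𝒳 → 𝒴 → ℝ)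
    (f : (Fin q → ZMod 2) ≃ 𝒳) (β : ℝ) (n : ℕ) : Set (Fin q × Fin (2 ^ n)) :=
  {a | 1 - deltaN β n < ZBout PX W f n a.1 a.2}




universe u

/-- A binary source with side information: `a v = P(T=0,V=v)`, `b v = P(T=1,V=v)`. -/
structure BS where
  V : Type u
  inst : Fintype V
  a : V → ℝ
  b : V → ℝ
  ha : ∀ v, 0 ≤ a v
  hb : ∀ v, 0 ≤ b v
  hs : ∑ v, (a v + b v) = 1

attribute [instance] BS.inst

namespace BS

def minus (S : BS.{u}) : BS.{u} where
  V := S.V × S.V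
  inst := inferInstance
  a := fun v => S.a v.1 * S.a v.2 + S.b v.1 * S.b v.2
  b := fun v => S.a v.1 * S.b v.2 + S.b v.1 * S.a v.2
  ha := fun v => add_nonneg (mul_nonneg (S.ha _) (S.ha _)) (mul_nonneg (S.hb _) (S.hb _))
  hb := fun v => add_nonneg (mul_nonneg (S.ha _) (S.hb _)) (mul_nonneg (S.hb _) (S.ha _))
  hs := by
    have : (∑ v, (S.a v + S.b v)) * (∑ v, (S.a v + S.b v)) = 1 := by rw [S.hs]; norm_num
    rw [← this, Finset.sum_mul_sum, Fintype.sum_prod_type]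
    refine Finset.sum_congr rfl fun v _ => Finset.sum_congr rfl fun w _ => ?_
    ring

def plus (S : BS.{u}) : BS.{u} where
  V := (S.V × S.V) ⊕ (S.V × S.V)
  inst := inferInstance
  a := Sum.elim (fun v => S.a v.1 * S.a v.2) (fun v => S.b v.1 * S.a v.2)
  b := Sum.elim (fun v => S.b v.1 * S.b v.2) (fun v => S.a v.1 * S.b v.2)
  ha := by
    rintro (v | v)
    · exact mul_nonneg (S.ha _) (S.ha _)
    · exact mul_nonneg (S.hb _) (S.ha _)
  hb := by
    rintro (v | v)
    · exact mul_nonneg (S.hb _) (S.hb _)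
    · exact mul_nonneg (S.ha _) (S.hb _)
  hs := by
    have : (∑ v, (S.a v + S.b v)) * (∑ v, (S.a v + S.b v)) = 1 := by rw [S.hs]; norm_num
    rw [← this, Finset.sum_mul_sum, Fintype.sum_sum_type, Fintype.sum_prod_type,
      Fintype.sum_prod_type, ← Finset.sum_add_distrib]
    refine Finset.sum_congr rfl fun v _ => ?_
    rw [← Finset.sum_add_distrib]
    refine Finset.sum_congr rfl fun w _ => ?_
    simp only [Sum.elim_inl, Sum.elim_inr]
    ring

/-- additive functional -/
def fn (S : BS.{u}) (φ : ℝ → ℝ → ℝ) : ℝ := ∑ v, φ (S.a v) (S.b v)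

lemma fn_minus (S : BS.{u}) (φ : ℝ → ℝ → ℝ) : S.minus.fn φ =
    ∑ v, ∑ w, φ (S.a v * S.a w + S.b v * S.b w) (S.a v * S.b w + S.b v * S.a w) := by
  unfold fn minus
  exact Fintype.sum_prod_type _

lemma fn_plus (S : BS.{u}) (φ : ℝ → ℝ → ℝ) : S.plus.fn φ =
    ∑ v, ∑ w, (φ (S.a v * S.a w) (S.b v * S.b w) + φ (S.b v * S.a w) (S.a v * S.b w)) := by
  have : S.plus.fn φ = ∑ v : (S.V × S.V) ⊕ (S.V × S.V), φ (Sum.elim (fun v => S.a v.1 * S.a v.2) (fun v => S.b v.1 * S.a v.2) v) (Sum.elim (fun v => S.b v.1 * S.b v.2) (fun v => S.a v.1 * S.b v.2) v) := rfl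
  rw [this, Fintype.sum_sum_type, Fintype.sum_prod_type, Fintype.sum_prod_type,
    ← Finset.sum_add_distrib]
  refine Finset.sum_congr rfl fun v _ => ?_
  rw [← Finset.sum_add_distrib]
  rfl

def zf (a b : ℝ) : ℝ := 2 * √(a * b)
def kf (a b : ℝ) : ℝ := |a - b|
def hf (a b : ℝ) : ℝ :=
  (Real.negMulLog a + Real.negMulLog b - Real.negMulLog (a + b)) / Real.log 2

def z (S : BS.{u}) : ℝ := S.fn zf
def k (S : BS.{u}) : ℝ := S.fn kf
def h (S : BS.{u}) : ℝ := S.fn hf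

lemma fn_mono (S : BS.{u}) {φ ψ : ℝ → ℝ → ℝ} (h : ∀ a b, 0 ≤ a → 0 ≤ b → φ a b ≤ ψ a b) :
    S.fn φ ≤ S.fn ψ := Finset.sum_le_sum fun v _ => h _ _ (S.ha v) (S.hb v)

lemma fn_add (S : BS.{u}) : S.fn (fun a b => a + b) = 1 := S.hs

lemma le_of_sq_le_sq' {x y : ℝ} (h : x ^ 2 ≤ y ^ 2) (hy : 0 ≤ y) : x ≤ y :=
  (abs_le_of_sq_le_sq' h hy).2

lemma zf_nonneg (a b : ℝ) : 0 ≤ zf a b := by unfold zf; positivity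
lemma kf_nonneg (a b : ℝ) : 0 ≤ kf a b := abs_nonneg _

lemma z_nonneg (S : BS.{u}) : 0 ≤ S.z := Finset.sum_nonneg fun _ _ => zf_nonneg _ _
lemma k_nonneg (S : BS.{u}) : 0 ≤ S.k := Finset.sum_nonneg fun _ _ => kf_nonneg _ _

lemma zf_sq {a b : ℝ} (ha : 0 ≤ a) (hb : 0 ≤ b) : zf a b ^ 2 = 4 * (a * b) := by
  unfold zf; rw [mul_pow, Real.sq_sqrt (mul_nonneg ha hb)]; norm_num

lemma kf_sq (a b : ℝ) : kf a b ^ 2 = (a - b) ^ 2 := by unfold kf; exact sq_abs _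

lemma zf_le {a b : ℝ} (ha : 0 ≤ a) (hb : 0 ≤ b) : zf a b ≤ a + b := by
  have := zf_sq ha hb
  nlinarith [zf_nonneg a b, sq_nonneg (a - b)]

lemma kf_le {a b : ℝ} (ha : 0 ≤ a) (hb : 0 ≤ b) : kf a b ≤ a + b := by
  unfold kf; rw [abs_le]; constructor <;> linarith

lemma z_le_one (S : BS.{u}) : S.z ≤ 1 := by
  rw [← S.fn_add]; exact S.fn_mono fun a b ha hb => zf_le ha hb

lemma k_le_one (S : BS.{u}) : S.k ≤ 1 := by
  rw [← S.fn_add]; exact S.fn_mono fun a b ha hb => kf_le ha hb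

lemma one_le_zk (S : BS.{u}) : 1 ≤ S.z + S.k := by
  rw [← S.fn_add]; unfold z k fn; rw [← Finset.sum_add_distrib]
  refine Finset.sum_le_sum fun v _ => ?_
  have h1 := zf_sq (S.ha v) (S.hb v)
  have h2 := kf_sq (S.a v) (S.b v)
  have := zf_nonneg (S.a v) (S.b v)
  have := kf_nonneg (S.a v) (S.b v)
  apply le_of_sq_le_sq' _ (by positivity)
  nlinarith

lemma zk_sq_le (S : BS.{u}) : S.z ^ 2 + S.k ^ 2 ≤ 1 := by
  set R := √(S.z ^ 2 + S.k ^ 2) with hR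
  have hR2 : R ^ 2 = S.z ^ 2 + S.k ^ 2 := Real.sq_sqrt (by positivity)
  have hR0 : 0 ≤ R := Real.sqrt_nonneg _
  have key : S.z * S.z + S.k * S.k ≤ R := by
    have h1 : R = ∑ v, (S.a v + S.b v) * R := by rw [← Finset.sum_mul, S.hs, one_mul]
    have h2 : S.z * S.z + S.k * S.k =
        ∑ v, (zf (S.a v) (S.b v) * S.z + kf (S.a v) (S.b v) * S.k) := by
      rw [Finset.sum_add_distrib, ← Finset.sum_mul, ← Finset.sum_mul]; rfl
    rw [h2]
    conv_rhs => rw [h1]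
    refine Finset.sum_le_sum fun v _ => ?_
    have e1 := zf_sq (S.ha v) (S.hb v)
    have e2 := kf_sq (S.a v) (S.b v)
    refine le_of_sq_le_sq' ?_ (mul_nonneg (add_nonneg (S.ha v) (S.hb v)) hR0)
    have : (S.a v + S.b v) ^ 2 = zf (S.a v) (S.b v) ^ 2 + kf (S.a v) (S.b v) ^ 2 := by
      rw [e1, e2]; ring
    rw [mul_pow, this, hR2]
    nlinarith [sq_nonneg (zf (S.a v) (S.b v) * S.k - kf (S.a v) (S.b v) * S.z)]
  nlinarith

lemma fn_sq (S : BS.{u}) (φ : ℝ → ℝ → ℝ) : (S.fn φ) ^ 2 =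
    ∑ v, ∑ w, φ (S.a v) (S.b v) * φ (S.a w) (S.b w) := by
  rw [sq]; unfold fn; rw [Finset.sum_mul_sum]

lemma fn_two (S : BS.{u}) (φ : ℝ → ℝ → ℝ) : 2 * S.fn φ =
    ∑ v, ∑ w, (φ (S.a v) (S.b v) * (S.a w + S.b w) + (S.a v + S.b v) * φ (S.a w) (S.b w)) := by
  have : ∀ v, ∑ w, (φ (S.a v) (S.b v) * (S.a w + S.b w) + (S.a v + S.b v) * φ (S.a w) (S.b w))
      = φ (S.a v) (S.b v) + (S.a v + S.b v) * ∑ w, φ (S.a w) (S.b w) := by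
    intro v
    rw [Finset.sum_add_distrib, ← Finset.mul_sum, ← Finset.mul_sum, S.hs, mul_one]
  simp only [this]
  rw [Finset.sum_add_distrib, ← Finset.sum_mul, S.hs]
  unfold fn; ring

lemma z_plus (S : BS.{u}) : S.plus.z = S.z ^ 2 := by
  unfold z; rw [fn_plus, fn_sq]
  refine Finset.sum_congr rfl fun v _ => Finset.sum_congr rfl fun w _ => ?_
  unfold zf
  have e1 : S.a v * S.a w * (S.b v * S.b w) = (S.a v * S.b v) * (S.a w * S.b w) := by ring
  have e2 : S.b v * S.a w * (S.a v * S.b w) = (S.a v * S.b v) * (S.a w * S.b w) := by ring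
  rw [e1, e2, Real.sqrt_mul (mul_nonneg (S.ha v) (S.hb v))]; ring

lemma k_minus (S : BS.{u}) : S.minus.k = S.k ^ 2 := by
  unfold k; rw [fn_minus, fn_sq]
  refine Finset.sum_congr rfl fun v _ => Finset.sum_congr rfl fun w _ => ?_
  unfold kf
  rw [← abs_mul]; congr 1; ring

lemma z_minus (S : BS.{u}) : S.minus.z ≤ 2 * S.z - S.z ^ 2 := by
  unfold z; rw [fn_minus, fn_sq, fn_two, ← Finset.sum_sub_distrib]
  refine Finset.sum_le_sum fun v _ => ?_
  rw [← Finset.sum_sub_distrib]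
  refine Finset.sum_le_sum fun w _ => ?_
  have ha := S.ha v; have hb := S.hb v; have hc := S.ha w; have hd := S.hb w
  generalize S.a v = a at *; generalize S.b v = b at *
  generalize S.a w = c at *; generalize S.b w = d at *
  have h1 := zf_sq ha hb
  have h2 := zf_sq hc hd
  have h3 := zf_sq (a := a * c + b * d) (b := a * d + b * c) (by positivity) (by positivity)
  have l1 := zf_le ha hb
  have l2 := zf_le hc hd
  have n1 := zf_nonneg a b
  have n2 := zf_nonneg c d
  generalize zf a b = p at *
  generalize zf c d = r at *
  refine le_of_sq_le_sq' ?_ (by nlinarith [mul_nonneg n1 n2])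
  rw [h3]
  have : 4 * ((a * c + b * d) * (a * d + b * c)) = p ^ 2 * (c + d) ^ 2 + (a + b) ^ 2 * r ^ 2 - p ^ 2 * r ^ 2 := by
    rw [h1, h2]; ring
  rw [this]
  have := mul_nonneg (mul_nonneg n1 n2) (mul_nonneg (sub_nonneg.2 l1) (sub_nonneg.2 l2))
  nlinarith

lemma k_plus (S : BS.{u}) : S.plus.k ≤ 2 * S.k - S.k ^ 2 := by
  unfold k; rw [fn_plus, fn_sq, fn_two, ← Finset.sum_sub_distrib]
  refine Finset.sum_le_sum fun v _ => ?_
  rw [← Finset.sum_sub_distrib]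
  refine Finset.sum_le_sum fun w _ => ?_
  have ha := S.ha v; have hb := S.hb v; have hc := S.ha w; have hd := S.hb w
  generalize S.a v = a at *; generalize S.b v = b at *
  generalize S.a w = c at *; generalize S.b w = d at *
  unfold kf
  rcases abs_cases (a - b) with ⟨h1, _⟩ | ⟨h1, _⟩ <;>
  rcases abs_cases (c - d) with ⟨h2, _⟩ | ⟨h2, _⟩ <;>
  rcases abs_cases (a * c - b * d) with ⟨h3, _⟩ | ⟨h3, _⟩ <;>
  rcases abs_cases (b * c - a * d) with ⟨h4, _⟩ | ⟨h4, _⟩ <;>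
  rw [h1, h2, h3, h4] <;>
  nlinarith [mul_nonneg ha hc, mul_nonneg ha hd, mul_nonneg hb hc, mul_nonneg hb hd]

lemma h_step (S : BS.{u}) : S.minus.h + S.plus.h = 2 * S.h := by
  unfold h; rw [fn_minus, fn_plus, fn_two, ← Finset.sum_add_distrib]
  refine Finset.sum_congr rfl fun v _ => ?_
  rw [← Finset.sum_add_distrib]
  refine Finset.sum_congr rfl fun w _ => ?_
  unfold hf
  generalize S.a v = a at *; generalize S.b v = b at *
  generalize S.a w = c at *; generalize S.b w = d at *
  have e : a * c + b * d + (a * d + b * c) = (a + b) * (c + d) := by ring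
  have e1 : b * c + a * d = a * d + b * c := by ring
  rw [e, e1]
  simp only [Real.negMulLog_mul]
  ring

lemma hf_eq {a b : ℝ} (hx : 0 < a + b) :
    hf a b = (a + b) * Real.binEntropy (a / (a + b)) / Real.log 2 := by
  unfold hf
  rw [Real.binEntropy_eq_negMulLog_add_negMulLog_one_sub]
  have e1 : 1 - a / (a + b) = b / (a + b) := by field_simp; ring
  rw [e1]
  have h1 : Real.negMulLog a = Real.negMulLog ((a + b) * (a / (a + b))) := by
    rw [mul_div_cancel₀ _ hx.ne']
  have h2 : Real.negMulLog b = Real.negMulLog ((a + b) * (b / (a + b))) := by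
    rw [mul_div_cancel₀ _ hx.ne']
  rw [h1, h2, Real.negMulLog_mul, Real.negMulLog_mul]
  have : a / (a + b) * Real.negMulLog (a + b) + b / (a + b) * Real.negMulLog (a + b)
      = Real.negMulLog (a + b) := by field_simp
  congr 1
  linarith

lemma hf_zero_zero : hf 0 0 = 0 := by simp [hf]

lemma sum_pos_or {a b : ℝ} (ha : 0 ≤ a) (hb : 0 ≤ b) : (a = 0 ∧ b = 0) ∨ 0 < a + b := by
  rcases ha.eq_or_lt with h | h
  · rcases hb.eq_or_lt with h' | h'
    · left; exact ⟨h.symm, h'.symm⟩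
    · right; linarith
  · right; linarith

lemma negMulLog_bound {t : ℝ} (h0 : 0 ≤ t) (h1 : t ≤ 1) :
    Real.negMulLog t ≤ 2 * √(t * (1 - t)) := by
  rcases h0.eq_or_lt with h | h
  · rw [← h]; simp
  have hs : 0 < √t := Real.sqrt_pos.2 h
  have hsq : √t ^ 2 = t := Real.sq_sqrt h0
  have hl : -Real.log t ≤ 2 * ((√t)⁻¹ - 1) := by
    have := Real.log_le_sub_one_of_pos (inv_pos.2 hs)
    rw [Real.log_inv, Real.log_sqrt h0] at this
    linarith
  have h2 : Real.negMulLog t ≤ 2 * (√t - t) := by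
    unfold Real.negMulLog
    have := mul_le_mul_of_nonneg_left hl h0
    have e : t * (√t)⁻¹ = √t := by
      field_simp; linarith
    nlinarith
  have hs1 : √t ≤ 1 := Real.sqrt_le_one.2 h1
  refine h2.trans ?_
  have : √t - t ≤ √(t * (1 - t)) := by
    apply Real.le_sqrt_of_sq_le
    have : (√t - t) = √t * (1 - √t) := by rw [mul_sub, mul_one, ← sq, hsq]
    rw [this, mul_pow, hsq]
    apply mul_le_mul_of_nonneg_left _ h0
    nlinarith
  linarith

lemma hf_le_zf {a b : ℝ} (ha : 0 ≤ a) (hb : 0 ≤ b) : hf a b ≤ 4 * zf a b := by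
  rcases sum_pos_or ha hb with ⟨rfl, rfl⟩ | hx
  · rw [hf_zero_zero]; have := zf_nonneg 0 0; linarith
  rw [hf_eq hx]
  have hl : (1 : ℝ) / 2 ≤ Real.log 2 := by have := Real.log_two_gt_d9; linarith
  have hl0 : 0 < Real.log 2 := by linarith
  rw [div_le_iff₀ hl0]
  set t := a / (a + b) with ht
  have t0 : 0 ≤ t := by positivity
  have t1 : t ≤ 1 := by rw [ht, div_le_one hx]; linarith
  have h1 := negMulLog_bound t0 t1
  have h2 := negMulLog_bound (t := 1 - t) (by linarith) (by linarith)
  rw [show (1 - t) * (1 - (1 - t)) = t * (1 - t) by ring] at h2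
  rw [Real.binEntropy_eq_negMulLog_add_negMulLog_one_sub]
  have e : zf a b = 2 * ((a + b) * √(t * (1 - t))) := by
    unfold zf
    have e0 : a * b = (a + b) ^ 2 * (t * (1 - t)) := by rw [ht]; field_simp; ring
    rw [e0, Real.sqrt_mul (sq_nonneg _), Real.sqrt_sq hx.le]
  have hz := zf_nonneg a b
  have : (a + b) * (Real.negMulLog t + Real.negMulLog (1 - t)) ≤ (a + b) * (4 * √(t * (1 - t))) :=
    mul_le_mul_of_nonneg_left (by linarith) hx.le
  nlinarith

lemma hf_le {a b : ℝ} (ha : 0 ≤ a) (hb : 0 ≤ b) : hf a b ≤ a + b := by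
  rcases sum_pos_or ha hb with ⟨rfl, rfl⟩ | hx
  · rw [hf_zero_zero]; norm_num
  rw [hf_eq hx, div_le_iff₀ (Real.log_pos (by norm_num))]
  exact mul_le_mul_of_nonneg_left Real.binEntropy_le_log_two hx.le

lemma binEntropy_lower {t : ℝ} (h0 : 0 ≤ t) (h1 : t ≤ 2⁻¹) :
    2 * t * Real.log 2 ≤ Real.binEntropy t := by
  have hc := Real.strictConcave_binEntropy.concaveOn
  have := hc.2 (show (0 : ℝ) ∈ Set.Icc 0 1 by norm_num) (show (2⁻¹ : ℝ) ∈ Set.Icc 0 1 by norm_num)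
    (show 0 ≤ 1 - 2 * t by linarith) (show 0 ≤ 2 * t by linarith) (by ring)
  simp only [smul_eq_mul, mul_zero, zero_add, Real.binEntropy_zero, Real.binEntropy_two_inv] at this
  rwa [show 2 * t * 2⁻¹ = t by ring] at this

lemma le_hf {a b : ℝ} (ha : 0 ≤ a) (hb : 0 ≤ b) : a + b - kf a b ≤ hf a b := by
  wlog hab : a ≤ b generalizing a b
  · have := this hb ha (by linarith)
    have e : hf a b = hf b a := by unfold hf; rw [add_comm b a]; ring
    have e' : kf a b = kf b a := abs_sub_comm _ _
    rw [e, e']; linarith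
  rcases sum_pos_or ha hb with ⟨rfl, rfl⟩ | hx
  · rw [hf_zero_zero]; simp [kf]
  rw [hf_eq hx, le_div_iff₀ (Real.log_pos (by norm_num))]
  have e : a + b - kf a b = 2 * a := by
    unfold kf; rw [abs_of_nonpos (by linarith)]; ring
  rw [e]
  have := binEntropy_lower (t := a / (a + b)) (by positivity) (by
    rw [div_le_iff₀ hx]; linarith)
  have := mul_le_mul_of_nonneg_left this hx.le
  have e2 : (a + b) * (2 * (a / (a + b)) * Real.log 2) = 2 * a * Real.log 2 := by
    field_simp
  linarith

lemma h_le_z (S : BS.{u}) : S.h ≤ 4 * S.z := by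
  unfold z h fn; rw [Finset.mul_sum]
  exact Finset.sum_le_sum fun v _ => hf_le_zf (S.ha v) (S.hb v)
lemma h_le_one (S : BS.{u}) : S.h ≤ 1 := by
  rw [← S.fn_add]; exact S.fn_mono fun a b ha hb => hf_le ha hb
lemma one_sub_k_le_h (S : BS.{u}) : 1 - S.k ≤ S.h := by
  rw [← S.fn_add]; unfold k h fn; rw [← Finset.sum_sub_distrib]
  exact Finset.sum_le_sum fun v _ => le_hf (S.ha v) (S.hb v)

lemma sqrt_bound {z k : ℝ} (hz : 0 ≤ z) (hk : 0 ≤ k) (hz1 : z ≤ 1) (hk1 : k ≤ 1)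
    (h : z ^ 2 + k ^ 2 ≤ 1) : √(z * (2 - k)) + √(k * (2 - z)) ≤ 2 * 0.999 := by
  wlog hzk : z ≤ k generalizing z k
  · rw [add_comm]
    exact this hk hz hk1 hz1 (by linarith) (by linarith)
  by_cases hc : k ≤ 0.95
  · have h1 := Real.sq_sqrt (x := z * (2 - k)) (by nlinarith)
    have h2 := Real.sq_sqrt (x := k * (2 - z)) (by nlinarith)
    apply le_of_sq_le_sq' _ (by norm_num)
    nlinarith [sq_nonneg (√(z * (2 - k)) - √(k * (2 - z))),
      mul_nonneg (sub_nonneg.2 hc) (sub_nonneg.2 (hzk.trans hc))]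
  · push Not at hc
    have hz2 : z ≤ 0.3125 := by
      apply le_of_sq_le_sq' _ (by norm_num)
      nlinarith
    have h1 : √(z * (2 - k)) ≤ 0.58 := by
      apply Real.sqrt_le_iff.2
      constructor
      · norm_num
      · nlinarith
    have h2 : √(k * (2 - z)) ≤ 1.4143 := by
      apply Real.sqrt_le_iff.2
      constructor
      · norm_num
      · nlinarith
    linarith

lemma pot_step (S : BS.{u}) : √(S.minus.z * S.minus.k) + √(S.plus.z * S.plus.k) ≤
    2 * 0.999 * √(S.z * S.k) := by
  have hz := S.z_nonneg; have hk := S.k_nonneg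
  have h1 : √(S.minus.z * S.minus.k) ≤ √(S.z * S.k) * √(S.k * (2 - S.z)) := by
    rw [← Real.sqrt_mul (mul_nonneg hz hk)]
    apply Real.sqrt_le_sqrt
    rw [k_minus]
    have := mul_le_mul_of_nonneg_right S.z_minus (sq_nonneg S.k)
    nlinarith
  have h2 : √(S.plus.z * S.plus.k) ≤ √(S.z * S.k) * √(S.z * (2 - S.k)) := by
    rw [← Real.sqrt_mul (mul_nonneg hz hk)]
    apply Real.sqrt_le_sqrt
    rw [z_plus]
    have := mul_le_mul_of_nonneg_left S.k_plus (sq_nonneg S.z)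
    nlinarith
  have h3 := sqrt_bound hz hk S.z_le_one S.k_le_one S.zk_sq_le
  nlinarith [Real.sqrt_nonneg (S.z * S.k)]

end BS


namespace BS

/-- average over all `2^n` descendants -/
def av : ℕ → (BS.{u} → ℝ) → BS.{u} → ℝ
  | 0, F, S => F S
  | n + 1, F, S => (av n F S.minus + av n F S.plus) / 2

lemma av_mono {F G : BS.{u} → ℝ} (h : ∀ S, F S ≤ G S) (n : ℕ) : ∀ S, av n F S ≤ av n G S := by
  induction n with
  | zero => exact h
  | succ n ih => intro S; simp only [av]; linarith [ih S.minus, ih S.plus]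

lemma av_comp (F : BS.{u} → ℝ) (m n : ℕ) : ∀ S, av (m + n) F S = av m (av n F) S := by
  induction m with
  | zero => intro S; simp [av]
  | succ m ih => intro S; rw [show m + 1 + n = (m + n) + 1 by ring]; simp only [av, ih]

lemma av_add (F G : BS.{u} → ℝ) (n : ℕ) : ∀ S, av n (fun S => F S + G S) S = av n F S + av n G S := by
  induction n with
  | zero => intro S; rfl
  | succ n ih => intro S; simp only [av, ih]; ring

lemma av_mul (c : ℝ) (F : BS.{u} → ℝ) (n : ℕ) : ∀ S, av n (fun S => c * F S) S = c * av n F S := by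
  induction n with
  | zero => intro S; rfl
  | succ n ih => intro S; simp only [av, ih]; ring

lemma av_const (c : ℝ) (n : ℕ) : ∀ S : BS.{u}, av n (fun _ => c) S = c := by
  induction n with
  | zero => intro S; rfl
  | succ n ih => intro S; simp only [av, ih]; ring

lemma av_h (n : ℕ) : ∀ S : BS.{u}, av n h S = S.h := by
  induction n with
  | zero => intro S; rfl
  | succ n ih => intro S; simp only [av, ih]; linarith [S.h_step]

lemma av_pot (n : ℕ) : ∀ S : BS.{u}, av n (fun S => √(S.z * S.k)) S ≤ 0.999 ^ n * √(S.z * S.k) := by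
  induction n with
  | zero => intro S; simp [av]
  | succ n ih =>
    intro S; simp only [av]
    have h1 := ih S.minus
    have h2 := ih S.plus
    have h3 := mul_le_mul_of_nonneg_left S.pot_step (show (0:ℝ) ≤ 0.999 ^ n by positivity)
    rw [pow_succ]
    linarith

def ind (x : BS.{u} → ℝ) (d : ℝ) (S : BS.{u}) : ℝ := if d ≤ x S then 1 else 0

lemma win (x : BS.{u} → ℝ) (hx0 : ∀ S, 0 ≤ x S)
    (hx : ∀ S : BS.{u}, (x S.plus ≤ x S ^ 2 ∧ x S.minus ≤ 2 * x S) ∨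
      (x S.minus ≤ x S ^ 2 ∧ x S.plus ≤ 2 * x S))
    {s T : ℝ} (hs : 0 < s) (hT : 0 < T) (k : ℕ) : ∀ (S : BS.{u}) (L : ℝ), (k : ℝ) < L →
    x S ≤ 2 ^ (-L) → av k (ind x (2 ^ (-T))) S ≤
      ((1 + 2 ^ (-s)) / 2) ^ k * (T / (L - k)) ^ s := by
  induction k with
  | zero =>
    intro S L hL hxS
    simp only [av, ind, Nat.cast_zero, sub_zero, pow_zero, one_mul]
    simp only [Nat.cast_zero] at hL
    split_ifs with hc
    · apply Real.one_le_rpow _ hs.le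
      rw [one_le_div hL]
      have := hc.trans hxS
      rw [Real.rpow_le_rpow_left_iff (by norm_num)] at this
      linarith
    · positivity
  | succ k ih =>
    intro S L hL hxS
    push_cast at hL ⊢
    have hd : 0 < L - (k + 1) := by linarith
    set r : ℝ := (1 + 2 ^ (-s)) / 2 with hr
    have hr0 : 0 < r := by positivity
    have hsq : ∀ S', x S' ≤ x S ^ 2 → av k (ind x (2 ^ (-T))) S' ≤
        r ^ k * (2 ^ (-s) * (T / (L - (k + 1))) ^ s) := by
      intro S' h
      have h1 : x S' ≤ 2 ^ (-(2 * L)) := by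
        refine h.trans ?_
        have := pow_le_pow_left₀ (hx0 S) hxS 2
        refine this.trans (le_of_eq ?_)
        rw [← Real.rpow_natCast, ← Real.rpow_mul (by norm_num)]
        congr 1; push_cast; ring
      refine (ih S' (2 * L) (by linarith) h1).trans ?_
      apply mul_le_mul_of_nonneg_left _ (by positivity)
      rw [Real.rpow_neg (by norm_num), ← Real.inv_rpow (by norm_num),
        ← Real.mul_rpow (by norm_num) (by positivity)]
      apply Real.rpow_le_rpow _ _ hs.le
      · apply div_nonneg hT.le; linarith
      · rw [← div_eq_inv_mul, div_div]
        apply div_le_div_of_nonneg_left hT.le (by linarith)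
        linarith
    have hdb : ∀ S', x S' ≤ 2 * x S → av k (ind x (2 ^ (-T))) S' ≤
        r ^ k * ((T / (L - (k + 1))) ^ s) := by
      intro S' h
      have h1 : x S' ≤ 2 ^ (-(L - 1)) := by
        refine h.trans ?_
        rw [show -(L - 1) = -L + 1 by ring, Real.rpow_add (by norm_num), Real.rpow_one]
        linarith
      refine (ih S' (L - 1) (by linarith) h1).trans (le_of_eq ?_)
      congr 3; ring
    simp only [av]
    have key : r ^ (k + 1) * (T / (L - (k + 1))) ^ s =
      (r ^ k * (2 ^ (-s) * (T / (L - (k + 1))) ^ s) + r ^ k * ((T / (L - (k + 1))) ^ s)) / 2 := by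
      rw [pow_succ]
      conv_lhs => rw [hr]
      ring
    rw [key]
    rcases hx S with ⟨h1, h2⟩ | ⟨h1, h2⟩
    · linarith [hsq _ h1, hdb _ h2]
    · linarith [hsq _ h1, hdb _ h2]

lemma two_win (x : BS.{u} → ℝ) (hx0 : ∀ S, 0 ≤ x S)
    (hx : ∀ S : BS.{u}, (x S.plus ≤ x S ^ 2 ∧ x S.minus ≤ 2 * x S) ∨
      (x S.minus ≤ x S ^ 2 ∧ x S.plus ≤ 2 * x S))
    {s T M : ℝ} (hs : 0 < s) (hT : 0 < T) (a k : ℕ) (ha : 0 < a) (hM : (k : ℝ) ≤ M) (hM0 : 0 < M)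
    (S : BS.{u}) (hS : x S ≤ 2 ^ (-(2 * a : ℝ))) :
    av (a + k) (ind x (2 ^ (-T))) S ≤
      ((1 + 2 ^ (-s)) / 2) ^ a * (2 * M / a) ^ s + ((1 + 2 ^ (-s)) / 2) ^ k * (T / M) ^ s := by
  rw [av_comp]
  have ha' : (0 : ℝ) < a := by exact_mod_cast ha
  have h1 : ∀ S, av k (ind x (2 ^ (-T))) S ≤ ind x (2 ^ (-(2 * M))) S +
      ((1 + 2 ^ (-s)) / 2) ^ k * (T / M) ^ s := by
    intro S
    by_cases hc : 2 ^ (-(2 * M)) ≤ x S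
    · have : av k (ind x (2 ^ (-T))) S ≤ 1 := by
        rw [← av_const 1 k S]
        apply av_mono
        intro S; unfold ind; split_ifs <;> norm_num
      have h2 : ind x (2 ^ (-(2 * M))) S = 1 := by unfold ind; rw [if_pos hc]
      rw [h2]
      have : 0 ≤ ((1 + (2:ℝ) ^ (-s)) / 2) ^ k * (T / M) ^ s := by positivity
      linarith
    · have h2 : ind x (2 ^ (-(2 * M))) S = 0 := by unfold ind; rw [if_neg hc]
      rw [h2, zero_add]
      refine (win x hx0 hx hs hT k S (2 * M) (by linarith) (not_le.1 hc).le).trans ?_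
      apply mul_le_mul_of_nonneg_left _ (by positivity)
      apply Real.rpow_le_rpow _ _ hs.le
      · apply div_nonneg hT.le; linarith
      · apply div_le_div_of_nonneg_left hT.le hM0
        linarith
  refine (av_mono h1 a S).trans ?_
  rw [av_add, av_const]
  have := win x hx0 hx hs (show 0 < 2 * M by linarith) a S (2 * a) (by linarith) hS
  rw [show (2 * a - a : ℝ) = a by ring] at this
  linarith

def bad (d : ℝ) (S : BS.{u}) : ℝ := if d ≤ S.z ∧ d ≤ S.k then 1 else 0

lemma main_bound {s T M : ℝ} (hs : 0 < s) (hT : 0 < T) (m a k : ℕ) (ha : 0 < a)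
    (hM : (k : ℝ) ≤ M) (hM0 : 0 < M) (S : BS.{u}) :
    av (m + (a + k)) (bad (2 ^ (-T))) S ≤ 2 ^ (a + 1) * 0.999 ^ m +
      2 * (((1 + 2 ^ (-s)) / 2) ^ a * (2 * M / a) ^ s + ((1 + 2 ^ (-s)) / 2) ^ k * (T / M) ^ s) := by
  set E : ℝ := ((1 + 2 ^ (-s)) / 2) ^ a * (2 * M / a) ^ s + ((1 + 2 ^ (-s)) / 2) ^ k * (T / M) ^ s
    with hE
  have hE0 : 0 ≤ E := by positivity
  have hsq : ∀ x : ℝ, 0 ≤ x → 2 * x - x ^ 2 ≤ 2 * x := fun x _ => by nlinarith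
  rw [av_comp]
  have h1 : ∀ S, av (a + k) (bad (2 ^ (-T))) S ≤ 2 ^ (a + 1) * √(S.z * S.k) + 2 * E := by
    intro S
    have hp : 0 ≤ (2:ℝ) ^ (a + 1) * √(S.z * S.k) := by positivity
    by_cases hz : S.z ≤ 2 ^ (-(2 * a : ℝ))
    · have := two_win z z_nonneg (fun S => Or.inl ⟨S.z_plus.le, S.z_minus.trans (hsq _ S.z_nonneg)⟩)
        hs hT a k ha hM hM0 S hz
      have h2 : av (a + k) (bad (2 ^ (-T))) S ≤ av (a + k) (ind z (2 ^ (-T))) S := by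
        apply av_mono
        intro S; unfold bad ind
        split_ifs <;> first | (exfalso; tauto) | norm_num
      linarith
    by_cases hk : S.k ≤ 2 ^ (-(2 * a : ℝ))
    · have := two_win BS.k k_nonneg
        (fun S => Or.inr ⟨S.k_minus.le, S.k_plus.trans (hsq _ S.k_nonneg)⟩)
        hs hT a k ha hM hM0 S hk
      have h2 : av (a + k) (bad (2 ^ (-T))) S ≤ av (a + k) (ind BS.k (2 ^ (-T))) S := by
        apply av_mono
        intro S; unfold bad ind
        split_ifs <;> first | (exfalso; tauto) | norm_num
      linarith
    push Not at hz hk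
    have : av (a + k) (bad (2 ^ (-T))) S ≤ 1 := by
      rw [← av_const 1 (a + k) S]
      apply av_mono
      intro S; unfold bad; split_ifs <;> norm_num
    have e : (2:ℝ) ^ (-(2 * a : ℝ)) = ((2:ℝ) ^ a)⁻¹ ^ 2 := by
      rw [Real.rpow_neg (by norm_num), mul_comm, Real.rpow_mul (by norm_num)]
      simp
    rw [e] at hz hk
    have hb : ((2:ℝ) ^ (a + 1))⁻¹ ≤ √(S.z * S.k) := by
      apply Real.le_sqrt_of_sq_le
      rw [pow_succ 2 a, mul_inv, mul_pow]
      have h3 := S.one_le_zk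
      set y := ((2:ℝ) ^ a)⁻¹ ^ 2
      have hy : 0 ≤ y := by positivity
      rcases le_total S.z S.k with h4 | h4 <;> nlinarith
    have : 1 ≤ 2 ^ (a + 1) * √(S.z * S.k) := by
      rw [inv_le_iff_one_le_mul₀ (by positivity)] at hb
      linarith
    linarith
  refine (av_mono h1 m S).trans ?_
  rw [av_add, av_const, av_mul]
  have h2 := av_pot m S
  have h3 : √(S.z * S.k) ≤ 1 := by
    apply Real.sqrt_le_one.2
    nlinarith [S.z_nonneg, S.k_nonneg, S.z_le_one, S.k_le_one]
  have h4 : av m (fun S => √(S.z * S.k)) S ≤ 0.999 ^ m := by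
    refine h2.trans ?_
    have : (0:ℝ) ≤ 0.999 ^ m := by positivity
    nlinarith
  have := mul_le_mul_of_nonneg_left h4 (show (0:ℝ) ≤ 2 ^ (a + 1) by positivity)
  linarith

lemma exists_s {β : ℝ} (hβ0 : 0 < β) (hβ : β < 1 / 2) :
    ∃ s : ℝ, 0 < s ∧ (1 + (2:ℝ) ^ (-s)) / 2 ≤ 2 ^ (-(β * s)) := by
  set σ := 1 / 2 - β with hσ
  have hσ0 : 0 < σ := by linarith
  have hl : 0 < Real.log 2 := Real.log_pos (by norm_num)
  refine ⟨σ / Real.log 2, by positivity, ?_⟩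
  rw [Real.rpow_def_of_pos (by norm_num), Real.rpow_def_of_pos (by norm_num)]
  have e1 : Real.log 2 * -(σ / Real.log 2) = -σ := by field_simp
  have e2 : Real.log 2 * -(β * (σ / Real.log 2)) = -(β * σ) := by field_simp
  rw [e1, e2]
  have h1 : 1 - β * σ ≤ Real.exp (-(β * σ)) := by
    have := Real.add_one_le_exp (-(β * σ)); linarith
  have h2 : Real.exp (-σ) ≤ 1 - σ + σ ^ 2 := by
    rw [Real.exp_neg]
    rw [inv_le_iff_one_le_mul₀ (Real.exp_pos _)]
    have := Real.add_one_le_exp σ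
    have h3 : 0 < 1 - σ + σ ^ 2 := by nlinarith
    have := mul_le_mul_of_nonneg_left this h3.le
    nlinarith [pow_pos hσ0 3]
  nlinarith

lemma bad_tendsto {β : ℝ} (hβ0 : 0 < β) (hβ : β < 1 / 2) (S : BS.{u}) :
    Tendsto (fun n => av n (bad (deltaN β n)) S) atTop (𝓝 0) := by
  set β' := (β + 1 / 2) / 2 with hβ'
  obtain ⟨s, hs, hr⟩ := exists_s (β := β') (by linarith) (by linarith)
  obtain ⟨A, hA⟩ := exists_pow_lt_of_lt_one (show (0:ℝ) < 1 / 4 by norm_num)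
    (show (0.999:ℝ) < 1 by norm_num)
  obtain ⟨D, hD⟩ := exists_nat_gt ((A + 1) * β' / (β' - β))
  have hD0 : (0:ℝ) < D := lt_of_le_of_lt (div_nonneg (mul_nonneg (by positivity) (by linarith))
    (by linarith)) hD
  have hDn : 0 < D := by exact_mod_cast hD0
  rw [div_lt_iff₀ (by linarith)] at hD
  set r : ℝ := (1 + (2:ℝ) ^ (-s)) / 2 with hrdef
  have hr0 : 0 < r := by positivity
  have hr1 : r < 1 := by
    have : (2:ℝ) ^ (-s) < 1 := Real.rpow_lt_one_of_one_lt_of_neg (by norm_num) (by linarith)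
    rw [hrdef]; linarith
  have hdiv : Tendsto (fun n : ℕ => n / D) atTop atTop :=
    Filter.tendsto_atTop_atTop.2 fun b => ⟨b * D, fun n hn => (Nat.le_div_iff_mul_le hDn).2 hn⟩
  set B : ℕ → ℝ := fun n => 2 * (1 / 2) ^ (n / D) + 2 * (r ^ (n / D) * (4 * D) ^ s + (n:ℝ) ^ (-s))
    with hB
  have hBlim : Tendsto B atTop (𝓝 0) := by
    have t1 : Tendsto (fun n : ℕ => (1 / 2 : ℝ) ^ (n / D)) atTop (𝓝 0) :=
      (tendsto_pow_atTop_nhds_zero_of_lt_one (by norm_num) (by norm_num)).comp hdiv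
    have t2 : Tendsto (fun n : ℕ => r ^ (n / D)) atTop (𝓝 0) :=
      (tendsto_pow_atTop_nhds_zero_of_lt_one hr0.le hr1).comp hdiv
    have t3 : Tendsto (fun n : ℕ => (n : ℝ) ^ (-s)) atTop (𝓝 0) :=
      (tendsto_rpow_neg_atTop hs).comp tendsto_natCast_atTop_atTop
    have := (t1.const_mul 2).add (((t2.mul_const ((4 * D : ℝ) ^ s)).add t3).const_mul 2)
    rw [hB]
    simpa only [mul_zero, zero_mul, add_zero] using this
  refine squeeze_zero' (Eventually.of_forall fun n => ?_) ?_ hBlim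
  · rw [← av_const 0 n S]
    apply av_mono; intro S; unfold bad; split_ifs <;> norm_num
  filter_upwards [hdiv.eventually_ge_atTop 1, eventually_gt_atTop 0] with n hn hn0
  set a := n / D with ha
  have haD : a * D ≤ n := Nat.div_mul_le_self n D
  have haD' : n < D * (a + 1) := Nat.lt_mul_div_succ n hDn
  have hn0' : (0:ℝ) < n := by exact_mod_cast hn0
  have haR : (a:ℝ) * D ≤ n := by exact_mod_cast haD
  have haR' : (n:ℝ) < D * (a + 1) := by exact_mod_cast haD'
  have ha1 : (1:ℝ) ≤ a := by exact_mod_cast hn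
  -- `(A+1) a ≤ n`
  have hk0 : (A + 1) * a * β' ≤ n * (β' - β) := by
    have h1 : ((A:ℝ) + 1) * β' * a ≤ D * (β' - β) * a :=
      mul_le_mul_of_nonneg_right hD.le (by linarith)
    have h2 : (a:ℝ) * D * (β' - β) ≤ n * (β' - β) :=
      mul_le_mul_of_nonneg_right haR (by linarith)
    nlinarith
  have hle : (A + 1) * a ≤ n := by
    have : ((A:ℝ) + 1) * a ≤ n := by
      have h3 : n * (β' - β) ≤ n * β' := mul_le_mul_of_nonneg_left (by linarith) hn0'.le
      exact le_of_mul_le_mul_right (hk0.trans h3) (by linarith)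
    exact_mod_cast this
  obtain ⟨k, hk⟩ := Nat.exists_eq_add_of_le hle
  have hnk : n = A * a + (a + k) := by rw [hk]; ring
  have hkn : (k:ℝ) ≤ n := by exact_mod_cast (by omega : k ≤ n)
  have hkR : (n:ℝ) = A * a + (a + k) := by exact_mod_cast hnk
  have hT : (0:ℝ) < (2 ^ n : ℝ) ^ β := by positivity
  have := main_bound hs hT (A * a) a k hn hkn hn0' S
  rw [← hnk] at this
  refine this.trans ?_
  simp only [hB]
  have q1 : (2:ℝ) ^ (a + 1) * 0.999 ^ (A * a) ≤ 2 * (1 / 2) ^ a := by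
    rw [pow_mul, pow_succ, mul_assoc, mul_comm, mul_assoc, ← mul_pow]
    have : (0.999 ^ A * 2 : ℝ) ^ a ≤ (1 / 2) ^ a := by
      apply pow_le_pow_left₀ (by positivity)
      linarith
    linarith
  have q2 : r ^ a * (2 * n / a : ℝ) ^ s ≤ r ^ a * (4 * D) ^ s := by
    apply mul_le_mul_of_nonneg_left _ (by positivity)
    apply Real.rpow_le_rpow (by positivity) _ hs.le
    rw [div_le_iff₀ (by linarith)]
    nlinarith
  have q3 : r ^ k * ((2 ^ n : ℝ) ^ β / n) ^ s ≤ (n:ℝ) ^ (-s) := by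
    rw [Real.div_rpow (by positivity) (by positivity), Real.rpow_neg hn0'.le, div_eq_mul_inv,
      ← mul_assoc]
    apply mul_le_of_le_one_left (by positivity)
    have : r ^ k ≤ ((2:ℝ) ^ (-(β' * s))) ^ k := pow_le_pow_left₀ hr0.le hr k
    refine (mul_le_mul_of_nonneg_right this (by positivity)).trans ?_
    rw [← Real.rpow_natCast, ← Real.rpow_natCast, ← Real.rpow_mul (by norm_num),
      ← Real.rpow_mul (by norm_num), ← Real.rpow_mul (by norm_num), ← Real.rpow_add (by norm_num)]
    apply Real.rpow_le_one_of_one_le_of_nonpos (by norm_num)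
    have : (n:ℝ) * β ≤ β' * k := by
      have : (k:ℝ) = n - (A + 1) * a := by rw [hkR]; ring
      rw [this]; nlinarith
    nlinarith
  linarith

lemma delta_tendsto {β : ℝ} (hβ0 : 0 < β) : Tendsto (deltaN β) atTop (𝓝 0) := by
  unfold deltaN
  have h1 : Tendsto (fun n : ℕ => ((2:ℝ) ^ n) ^ β) atTop atTop :=
    (tendsto_rpow_atTop hβ0).comp (tendsto_pow_atTop_atTop_of_one_lt (by norm_num))
  exact (tendsto_rpow_atBot_of_base_gt_one 2 (by norm_num)).comp (tendsto_neg_atTop_atBot.comp h1)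

lemma av_abs_le {F G : BS.{u} → ℝ} (n : ℕ) (S : BS.{u}) (h : ∀ S, |F S| ≤ G S) :
    |av n F S| ≤ av n G S := by
  rw [abs_le]
  constructor
  · have := av_mono (F := fun S => (-1) * G S) (G := F) (fun S => by
      have := (abs_le.1 (h S)).1; linarith) n S
    rw [av_mul] at this; linarith
  · exact av_mono (fun S => (abs_le.1 (h S)).2) n S

lemma frac_tendsto {β : ℝ} (hβ0 : 0 < β) (hβ : β < 1 / 2) (S : BS.{u})
    (F : ℝ → BS.{u} → ℝ) (G : BS.{u} → ℝ) (c : ℝ) (hG : ∀ n, av n G S = c)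
    (hF : ∀ d S, 0 ≤ d → d ≤ 1 / 2 → |F d S - G S| ≤ 4 * d + bad d S) :
    Tendsto (fun n => av n (F (deltaN β n)) S) atTop (𝓝 c) := by
  rw [tendsto_iff_norm_sub_tendsto_zero]
  have hlim : Tendsto (fun n => 4 * deltaN β n + av n (bad (deltaN β n)) S) atTop (𝓝 0) := by
    simpa using ((delta_tendsto hβ0).const_mul 4).add (bad_tendsto hβ0 hβ S)
  refine squeeze_zero' (Eventually.of_forall fun n => norm_nonneg _) ?_ hlim
  filter_upwards [(delta_tendsto hβ0).eventually_le_const (show (0:ℝ) < 1 / 2 by norm_num)] with n hn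
  have h0 : 0 ≤ deltaN β n := by unfold deltaN; positivity
  have e : av n (F (deltaN β n)) S - c = av n (fun S => F (deltaN β n) S + (-1) * G S) S := by
    rw [av_add, av_mul, hG]; ring
  rw [Real.norm_eq_abs, e]
  refine (av_abs_le (G := fun S => 4 * deltaN β n + bad (deltaN β n) S) n S fun S => ?_).trans ?_
  · rw [show F (deltaN β n) S + -1 * G S = F (deltaN β n) S - G S by ring]
    exact hF _ S h0 hn
  · rw [av_add, av_const]

lemma L_tendsto {β : ℝ} (hβ0 : 0 < β) (hβ : β < 1 / 2) (S : BS.{u}) :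
    Tendsto (fun n => av n (fun S => if S.z < deltaN β n then 1 else 0) S) atTop (𝓝 (1 - S.h)) := by
  refine frac_tendsto hβ0 hβ S (fun d S => if S.z < d then 1 else 0) (fun S => 1 + (-1) * S.h) _ ?_ ?_
  · intro n; rw [av_add, av_const, av_mul, av_h]; ring
  · intro d S d0 d1
    have h1 := S.h_le_z; have h2 := S.h_le_one; have h3 := S.one_sub_k_le_h
    have h4 := S.k_le_one; have h5 := S.z_nonneg; have h6 := S.k_nonneg
    unfold bad
    split_ifs with c1 c2 c2 <;> rw [abs_le] <;> constructor <;>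
      first | linarith | (simp only [not_and, not_le, not_lt] at *; linarith [c2 c1])

lemma H_tendsto {β : ℝ} (hβ0 : 0 < β) (hβ : β < 1 / 2) (S : BS.{u}) :
    Tendsto (fun n => av n (fun S => if 1 - deltaN β n < S.z then 1 else 0) S) atTop
      (𝓝 S.h) := by
  refine frac_tendsto hβ0 hβ S (fun d S => if 1 - d < S.z then 1 else 0) (fun S => S.h) _ ?_ ?_
  · intro n; rw [av_h]
  · intro d S d0 d1
    have h1 := S.h_le_z; have h2 := S.h_le_one; have h3 := S.one_sub_k_le_h
    have h4 := S.k_le_one; have h5 := S.z_nonneg; have h6 := S.k_nonneg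
    have h7 := S.one_le_zk
    unfold bad
    by_cases hz : d ≤ S.z
    · by_cases hk : d ≤ S.k
      · have hc : d ≤ S.z ∧ d ≤ S.k := ⟨hz, hk⟩
        rw [if_pos hc]
        split_ifs <;> rw [abs_le] <;> constructor <;> linarith
      · rw [if_pos (by linarith), if_neg (by tauto), abs_le]; constructor <;> linarith
    · rw [if_neg (by linarith), if_neg (by tauto), abs_le]; constructor <;> linarith

/-- the `i`-th descendant at depth `n` -/
def desc (S : BS.{u}) : ℕ → ℕ → BS.{u}
  | 0, _ => S
  | n + 1, i => if i % 2 = 0 then (desc S n (i / 2)).minus else (desc S n (i / 2)).plus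

lemma sum_range_two_mul (f : ℕ → ℝ) (N : ℕ) :
    ∑ i ∈ Finset.range (2 * N), f i = ∑ i ∈ Finset.range N, (f (2 * i) + f (2 * i + 1)) := by
  induction N with
  | zero => simp
  | succ N ih =>
    rw [show 2 * (N + 1) = 2 * N + 1 + 1 by ring, Finset.sum_range_succ, Finset.sum_range_succ, ih,
      Finset.sum_range_succ]
    ring

lemma av_eq_sum (S : BS.{u}) (n : ℕ) : ∀ F : BS.{u} → ℝ,
    av n F S = (∑ i ∈ Finset.range (2 ^ n), F (desc S n i)) / 2 ^ n := by
  induction n with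
  | zero => intro F; simp [av, desc]
  | succ n ih =>
    intro F
    rw [av_comp F n 1, ih, pow_succ', sum_range_two_mul, pow_succ']
    have : ∀ i, av 1 F (desc S n i) =
        (F (S.desc (n + 1) (2 * i)) + F (S.desc (n + 1) (2 * i + 1))) / 2 := by
      intro i
      have e1 : (2 * i) % 2 = 0 := by omega
      have e2 : (2 * i + 1) % 2 ≠ 0 := by omega
      have e3 : 2 * i / 2 = i := by omega
      have e4 : (2 * i + 1) / 2 = i := by omega
      simp only [av, desc]
      rw [if_pos e1, if_neg e2, e3, e4]
    simp only [this]
    rw [← Finset.sum_div, div_div]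

end BS


section Link
set_option linter.unusedSectionVars false
variable {Ω : Type*} {𝒱 : Type u} [Fintype Ω] [Fintype 𝒱]

lemma zmod2 (x : ZMod 2) : x = 0 ∨ x = 1 := by
  revert x; decide

lemma sum_zmod2 (F : ZMod 2 → ℝ) : ∑ t, F t = F 0 + F 1 := Fin.sum_univ_two F

lemma dist_nonneg' {α : Type*} {p : Ω → ℝ} (hp : ∀ ω, 0 ≤ p ω) (X : Ω → α) (a : α) :
    0 ≤ dist p X a := by
  unfold dist
  exact Finset.sum_nonneg fun ω _ => by split_ifs <;> simp [hp]

lemma dist_pair (p : Ω → ℝ) (T : Ω → ZMod 2) {𝒱 : Type*} (V : Ω → 𝒱) (v : 𝒱) :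
    dist p (fun ω => (T ω, V ω)) (0, v) + dist p (fun ω => (T ω, V ω)) (1, v) = dist p V v := by
  unfold dist
  rw [← Finset.sum_add_distrib]
  refine Finset.sum_congr rfl fun ω _ => ?_
  rcases zmod2 (T ω) with h | h <;> by_cases h' : V ω = v <;> simp [h, h']

lemma sum_dist (p : Ω → ℝ) (V : Ω → 𝒱) : ∑ v, dist p V v = ∑ ω, p ω := by
  unfold dist
  rw [Finset.sum_comm]
  refine Finset.sum_congr rfl fun ω _ => ?_
  simp

/-- The source `(T, V)` under `p`. -/
def src (p : Ω → ℝ) (hp : IsPMF p) (T : Ω → ZMod 2) (V : Ω → 𝒱) : BS.{u} where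
  V := 𝒱
  inst := inferInstance
  a := fun v => dist p (fun ω => (T ω, V ω)) (0, v)
  b := fun v => dist p (fun ω => (T ω, V ω)) (1, v)
  ha := fun v => dist_nonneg' hp.1 _ _
  hb := fun v => dist_nonneg' hp.1 _ _
  hs := by
    simp only [dist_pair]
    rw [sum_dist, hp.2]

lemma src_h (p : Ω → ℝ) (hp : IsPMF p) (T : Ω → ZMod 2) (V : Ω → 𝒱) :
    (src p hp T V).h = condH p T V := by
  unfold condH H
  rw [Fintype.sum_prod_type, sum_zmod2, ← Finset.sum_add_distrib, ← Finset.sum_sub_distrib]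
  change ∑ v : 𝒱, BS.hf (dist p (fun ω => (T ω, V ω)) (0, v)) (dist p (fun ω => (T ω, V ω)) (1, v)) = _
  refine Finset.sum_congr rfl fun v _ => ?_
  unfold BS.hf
  rw [dist_pair]
  simp only [Real.negMulLog, Real.logb]
  ring

def iid (p : Ω → ℝ) (n : ℕ) : (Fin (2 ^ n) → Ω) → ℝ := fun ω => ∏ i, p (ω i)

def GNn (n i j : ℕ) : ZMod 2 :=
  if ∀ k < n, Nat.testBit j k → Nat.testBit i (n - 1 - k) then 1 else 0

def Un (T : Ω → ZMod 2) (n : ℕ) (ω : Fin (2 ^ n) → Ω) (i : ℕ) : ZMod 2 :=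
  ∑ j : Fin (2 ^ n), T (ω j) * GNn n j.val i

def eF (n : ℕ) : Fin (2 ^ n) ⊕ Fin (2 ^ n) ≃ Fin (2 ^ (n + 1)) :=
  finSumFinEquiv.trans (finCongr (by ring))

lemma eF_inl (n : ℕ) (j : Fin (2 ^ n)) : (eF n (Sum.inl j)).val = j.val := by
  simp [eF]
lemma eF_inr (n : ℕ) (j : Fin (2 ^ n)) : (eF n (Sum.inr j)).val = 2 ^ n + j.val := by
  simp [eF, add_comm]

def sp (n : ℕ) : (Fin (2 ^ n) → Ω) × (Fin (2 ^ n) → Ω) ≃ (Fin (2 ^ (n + 1)) → Ω) :=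
  (Equiv.sumArrowEquivProdArrow _ _ _).symm.trans (Equiv.arrowCongr (eF n) (Equiv.refl Ω))

lemma sp_inl (n : ℕ) (w : (Fin (2 ^ n) → Ω) × (Fin (2 ^ n) → Ω)) (j : Fin (2 ^ n)) :
    sp n w (eF n (Sum.inl j)) = w.1 j := by
  simp [sp, Equiv.sumArrowEquivProdArrow]
lemma sp_inr (n : ℕ) (w : (Fin (2 ^ n) → Ω) × (Fin (2 ^ n) → Ω)) (j : Fin (2 ^ n)) :
    sp n w (eF n (Sum.inr j)) = w.2 j := by
  simp [sp, Equiv.sumArrowEquivProdArrow]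

lemma iid_sp (p : Ω → ℝ) (n : ℕ) (w : (Fin (2 ^ n) → Ω) × (Fin (2 ^ n) → Ω)) :
    iid p (n + 1) (sp n w) = iid p n w.1 * iid p n w.2 := by
  unfold iid
  rw [← (eF n).prod_comp, Fintype.prod_sum_type]
  simp only [sp_inl, sp_inr]

lemma forall_sp (n : ℕ) (P : Fin (2 ^ (n + 1)) → Prop) :
    (∀ j, P j) ↔ (∀ j, P (eF n (Sum.inl j))) ∧ ∀ j, P (eF n (Sum.inr j)) := by
  rw [← (eF n).forall_congr_right, Sum.forall]

lemma GNn_lo_even (n j i : ℕ) (hj : j < 2 ^ n) : GNn (n + 1) j (2 * i) = GNn n j i := by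
  unfold GNn
  congr 1
  rw [eq_iff_iff]
  constructor
  · intro h k hk hb
    have := h (k + 1) (by omega) (by rwa [Nat.testBit_succ, Nat.mul_div_cancel_left _ (by norm_num)])
    rwa [show n + 1 - 1 - (k + 1) = n - 1 - k by omega] at this
  · intro h k hk hb
    cases k with
    | zero => simp at hb
    | succ k =>
      rw [Nat.testBit_succ, Nat.mul_div_cancel_left _ (by norm_num)] at hb
      rw [show n + 1 - 1 - (k + 1) = n - 1 - k by omega]
      exact h k (by omega) hb

lemma GNn_lo_odd (n j i : ℕ) (hj : j < 2 ^ n) : GNn (n + 1) j (2 * i + 1) = 0 := by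
  unfold GNn
  rw [if_neg]
  intro h
  have := h 0 (by omega) (by simp)
  simp only [Nat.add_sub_cancel, Nat.sub_zero] at this
  rw [Nat.testBit_lt_two_pow hj] at this
  exact absurd this (by simp)

lemma testBit_hi (n j k : ℕ) (hk : k < n) : (2 ^ n + j).testBit k = j.testBit k :=
  Nat.testBit_two_pow_add_gt hk j

lemma GNn_hi (n j i b : ℕ) (hj : j < 2 ^ n) (hb : b = 0 ∨ b = 1) :
    GNn (n + 1) (2 ^ n + j) (2 * i + b) = GNn n j i := by
  unfold GNn
  congr 1
  have hdiv : (2 * i + b) / 2 = i := by omega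
  rw [eq_iff_iff]
  constructor
  · intro h k hk hb
    have := h (k + 1) (by omega) (by rwa [Nat.testBit_succ, hdiv])
    rw [show n + 1 - 1 - (k + 1) = n - 1 - k by omega] at this
    rwa [testBit_hi _ _ _ (by omega)] at this
  · intro h k hk hb
    cases k with
    | zero =>
      simp only [Nat.add_sub_cancel, Nat.sub_zero]
      rw [Nat.testBit_two_pow_add_eq, Nat.testBit_lt_two_pow hj]
      rfl
    | succ k =>
      rw [Nat.testBit_succ, hdiv] at hb
      rw [show n + 1 - 1 - (k + 1) = n - 1 - k by omega, testBit_hi _ _ _ (by omega)]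
      exact h k (by omega) hb

lemma Un_even (T : Ω → ZMod 2) (n : ℕ) (w : (Fin (2 ^ n) → Ω) × (Fin (2 ^ n) → Ω)) (i : ℕ) :
    Un T (n + 1) (sp n w) (2 * i) = Un T n w.1 i + Un T n w.2 i := by
  unfold Un
  rw [← (eF n).sum_comp, Fintype.sum_sum_type]
  congr 1
  · refine Finset.sum_congr rfl fun j _ => ?_
    rw [sp_inl, eF_inl, GNn_lo_even _ _ _ j.2]
  · refine Finset.sum_congr rfl fun j _ => ?_
    rw [sp_inr, eF_inr]
    rw [show 2 * i = 2 * i + 0 by rfl, GNn_hi _ _ _ _ j.2 (Or.inl rfl)]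

lemma Un_odd (T : Ω → ZMod 2) (n : ℕ) (w : (Fin (2 ^ n) → Ω) × (Fin (2 ^ n) → Ω)) (i : ℕ) :
    Un T (n + 1) (sp n w) (2 * i + 1) = Un T n w.2 i := by
  unfold Un
  rw [← (eF n).sum_comp, Fintype.sum_sum_type]
  have : ∑ j, T (sp n w (eF n (Sum.inl j))) * GNn (n + 1) (eF n (Sum.inl j)).val (2 * i + 1) = 0 := by
    apply Finset.sum_eq_zero
    intro j _
    rw [eF_inl, GNn_lo_odd _ _ _ j.2, mul_zero]
  rw [this, zero_add]
  refine Finset.sum_congr rfl fun j _ => ?_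
  rw [sp_inr, eF_inr, GNn_hi _ _ _ _ j.2 (Or.inr rfl)]

lemma dist_sp {α : Type*} (p : Ω → ℝ) (n : ℕ) (X : (Fin (2 ^ (n + 1)) → Ω) → α) (c : α) :
    dist (iid p (n + 1)) X c =
      ∑ x, ∑ y, if X (sp n (x, y)) = c then iid p n x * iid p n y else 0 := by
  unfold dist
  rw [← (sp n).sum_comp, Fintype.sum_prod_type]
  simp only [iid_sp]

lemma even_kernel (T : Ω → ZMod 2) (n i : ℕ) (w w' : (Fin (2 ^ n) → Ω) × (Fin (2 ^ n) → Ω)) :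
    (∀ j < 2 * i, Un T (n + 1) (sp n w) j = Un T (n + 1) (sp n w') j) ↔
    (∀ j < i, Un T n w.1 j = Un T n w'.1 j) ∧ (∀ j < i, Un T n w.2 j = Un T n w'.2 j) := by
  constructor
  · intro h
    have h2 : ∀ j < i, Un T n w.2 j = Un T n w'.2 j := by
      intro j hj
      have := h (2 * j + 1) (by omega)
      rwa [Un_odd, Un_odd] at this
    refine ⟨?_, h2⟩
    intro j hj
    have := h (2 * j) (by omega)
    rw [Un_even, Un_even, h2 j hj] at this
    exact add_right_cancel this
  · rintro ⟨h1, h2⟩ j hj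
    rcases Nat.even_or_odd' j with ⟨c, rfl | rfl⟩
    · rw [Un_even, Un_even, h1 c (by omega), h2 c (by omega)]
    · rw [Un_odd, Un_odd, h2 c (by omega)]

lemma lt_two_mul_add_one {P : ℕ → Prop} (i : ℕ) :
    (∀ j < 2 * i + 1, P j) ↔ (∀ j < 2 * i, P j) ∧ P (2 * i) := by
  constructor
  · intro h; exact ⟨fun j hj => h j (by omega), h _ (by omega)⟩
  · rintro ⟨h, h'⟩ j hj
    rcases (show j < 2 * i ∨ j = 2 * i by omega) with h1 | rfl
    · exact h j h1
    · exact h'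

/-- `S` is the law of `(U_i, side information)` -/
def Rep (p : Ω → ℝ) (T : Ω → ZMod 2) (V : Ω → 𝒱) (n i : ℕ) (S : BS.{u}) : Prop :=
  ∃ g : (Fin (2 ^ n) → Ω) → S.V,
    (∀ ω ω', g ω = g ω' ↔ (∀ j < i, Un T n ω j = Un T n ω' j) ∧ ∀ j, V (ω j) = V (ω' j)) ∧
    (∀ v, S.a v = dist (iid p n) (fun ω => (Un T n ω i, g ω)) (0, v)) ∧
    (∀ v, S.b v = dist (iid p n) (fun ω => (Un T n ω i, g ω)) (1, v))

lemma rep_zero (p : Ω → ℝ) (hp : IsPMF p) (T : Ω → ZMod 2) (V : Ω → 𝒱) :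
    Rep p T V 0 0 (src p hp T V) := by
  have hU : ∀ ω : Fin (2 ^ 0) → Ω, Un T 0 ω 0 = T (ω ⟨0, by norm_num⟩) := by
    intro ω
    have h := Fin.sum_univ_one (fun j : Fin 1 => T (ω j) * GNn 0 j.val 0)
    refine h.trans ?_
    simp [GNn]
  have hd : ∀ c, dist (iid p 0) (fun ω => (Un T 0 ω 0, V (ω ⟨0, by norm_num⟩))) c =
      dist p (fun ω => (T ω, V ω)) c := by
    intro c
    unfold dist
    refine Fintype.sum_equiv (Equiv.funUnique (Fin 1) Ω) _ _ fun ω => ?_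
    have : iid p 0 ω = p (ω ⟨0, by norm_num⟩) :=
      Fin.prod_univ_one (fun j : Fin 1 => p (ω j))
    have h := hU ω
    simp only [h, this]
    have h0 : (Equiv.funUnique (Fin 1) Ω) ω = ω ⟨0, by norm_num⟩ := rfl
    rw [h0]
    by_cases hc : (T (ω ⟨0, by norm_num⟩), V (ω ⟨0, by norm_num⟩)) = c
    · rw [if_pos hc, if_pos hc]
    · rw [if_neg hc, if_neg hc]
  refine ⟨fun ω => V (ω ⟨0, by norm_num⟩), ?_, fun v => (hd _).symm, fun v => (hd _).symm⟩
  intro ω ω'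
  constructor
  · intro h
    refine ⟨fun j hj => by omega, fun j => ?_⟩
    have : j = ⟨0, by norm_num⟩ := by ext; have := j.2; simp at this; simp [this]
    rw [this]; exact h
  · intro h; exact h.2 _

lemma rep_minus {p : Ω → ℝ} {T : Ω → ZMod 2} {V : Ω → 𝒱} {n i : ℕ} {S : BS.{u}}
    (h : Rep p T V n i S) : Rep p T V (n + 1) (2 * i) S.minus := by
  obtain ⟨g, hg, ha, hb⟩ := h
  have h11 : (1 : ZMod 2) + 1 = 0 := by decide
  refine ⟨fun ω => (g ((sp n).symm ω).1, g ((sp n).symm ω).2), ?_, ?_, ?_⟩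
  · intro ω ω'
    obtain ⟨w, rfl⟩ := (sp n).surjective ω
    obtain ⟨w', rfl⟩ := (sp n).surjective ω'
    rw [even_kernel, forall_sp]
    simp only [sp_inl, sp_inr, Equiv.symm_apply_apply]
    change ((g w.1, g w.2) : S.V × S.V) = (g w'.1, g w'.2) ↔ _
    rw [Prod.mk.injEq, hg, hg]
    tauto
  · rintro ⟨v, w⟩
    change S.a v * S.a w + S.b v * S.b w = dist (iid p (n + 1)) (fun ω =>
      ((Un T (n + 1) ω (2 * i), (g ((sp n).symm ω).1, g ((sp n).symm ω).2)) : ZMod 2 × (S.V × S.V)))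
      (0, (v, w))
    rw [dist_sp, ha, ha, hb, hb]
    unfold dist
    rw [Finset.sum_mul_sum, Finset.sum_mul_sum, ← Finset.sum_add_distrib]
    refine Finset.sum_congr rfl fun x _ => ?_
    rw [← Finset.sum_add_distrib]
    refine Finset.sum_congr rfl fun y _ => ?_
    simp only [Equiv.symm_apply_apply, Un_even, Prod.mk.injEq]
    rcases zmod2 (Un T n x i) with h1 | h1 <;> rcases zmod2 (Un T n y i) with h2 | h2 <;>
    by_cases h3 : g x = v <;> by_cases h4 : g y = w <;> simp [h1, h2, h3, h4, h11]
  · rintro ⟨v, w⟩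
    change S.a v * S.b w + S.b v * S.a w = dist (iid p (n + 1)) (fun ω =>
      ((Un T (n + 1) ω (2 * i), (g ((sp n).symm ω).1, g ((sp n).symm ω).2)) : ZMod 2 × (S.V × S.V)))
      (1, (v, w))
    rw [dist_sp, ha, ha, hb, hb]
    unfold dist
    rw [Finset.sum_mul_sum, Finset.sum_mul_sum, ← Finset.sum_add_distrib]
    refine Finset.sum_congr rfl fun x _ => ?_
    rw [← Finset.sum_add_distrib]
    refine Finset.sum_congr rfl fun y _ => ?_
    simp only [Equiv.symm_apply_apply, Un_even, Prod.mk.injEq]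
    rcases zmod2 (Un T n x i) with h1 | h1 <;> rcases zmod2 (Un T n y i) with h2 | h2 <;>
    by_cases h3 : g x = v <;> by_cases h4 : g y = w <;> simp [h1, h2, h3, h4, h11]

def gplus {A B : Type*} (s : ZMod 2) (a : A) (b : B) : (A × B) ⊕ (A × B) :=
  if s = 0 then Sum.inl (a, b) else Sum.inr (a, b)

lemma gplus_eq {A B : Type*} (s s' : ZMod 2) (a a' : A) (b b' : B) :
    gplus s a b = gplus s' a' b' ↔ s = s' ∧ a = a' ∧ b = b' := by
  rcases zmod2 s with rfl | rfl <;> rcases zmod2 s' with rfl | rfl <;> simp [gplus]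

lemma gplus_inl {A B : Type*} (s : ZMod 2) (a : A) (b : B) (v : A × B) :
    gplus s a b = Sum.inl v ↔ s = 0 ∧ a = v.1 ∧ b = v.2 := by
  obtain ⟨v, w⟩ := v
  rcases zmod2 s with rfl | rfl <;> simp [gplus]

lemma gplus_inr {A B : Type*} (s : ZMod 2) (a : A) (b : B) (v : A × B) :
    gplus s a b = Sum.inr v ↔ s = 1 ∧ a = v.1 ∧ b = v.2 := by
  obtain ⟨v, w⟩ := v
  rcases zmod2 s with rfl | rfl <;> simp [gplus]

lemma rep_plus_law {A : Type*} {p : Ω → ℝ} {T : Ω → ZMod 2} {n i : ℕ}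
    (g : (Fin (2 ^ n) → Ω) → A) (s t : ZMod 2) (v w : A) :
    dist (iid p n) (fun ω => (Un T n ω i, g ω)) (s + t, v) *
    dist (iid p n) (fun ω => (Un T n ω i, g ω)) (t, w) =
    dist (iid p (n + 1)) (fun ω =>
      (Un T (n + 1) ω (2 * i + 1), gplus (Un T (n + 1) ω (2 * i))
         (g ((sp n).symm ω).1) (g ((sp n).symm ω).2)))
      (t, if s = 0 then Sum.inl (v, w) else Sum.inr (v, w)) := by
  rw [dist_sp]
  have h11 : (1 : ZMod 2) + 1 = 0 := by decide
  unfold dist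
  rw [Finset.sum_mul_sum]
  refine Finset.sum_congr rfl fun x _ => ?_
  refine Finset.sum_congr rfl fun y _ => ?_
  simp only [Equiv.symm_apply_apply, Un_even, Un_odd, Prod.mk.injEq]
  rcases zmod2 (Un T n x i) with h1 | h1 <;> rcases zmod2 (Un T n y i) with h2 | h2 <;>
  rcases zmod2 s with rfl | rfl <;> rcases zmod2 t with rfl | rfl <;>
    simp [h1, h2, h11, gplus_inl, gplus_inr, ite_and] <;>
    (split_ifs <;> rfl)

lemma rep_plus {p : Ω → ℝ} {T : Ω → ZMod 2} {V : Ω → 𝒱} {n i : ℕ} {S : BS.{u}}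
    (h : Rep p T V n i S) : Rep p T V (n + 1) (2 * i + 1) S.plus := by
  obtain ⟨g, hg, ha, hb⟩ := h
  have h11 : (1 : ZMod 2) + 1 = 0 := by decide
  refine ⟨fun ω => gplus (Un T (n + 1) ω (2 * i))
         (g ((sp n).symm ω).1) (g ((sp n).symm ω).2), ?_, ?_, ?_⟩
  · intro ω ω'
    obtain ⟨w, rfl⟩ := (sp n).surjective ω
    obtain ⟨w', rfl⟩ := (sp n).surjective ω'
    rw [lt_two_mul_add_one, even_kernel, forall_sp]
    simp only [sp_inl, sp_inr, Equiv.symm_apply_apply]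
    refine (gplus_eq _ _ _ _ _ _).trans ?_
    rw [hg, hg]
    tauto
  · rintro (⟨v, w⟩ | ⟨v, w⟩)
    · change S.a v * S.a w = _
      rw [ha, ha]
      have := rep_plus_law (p := p) (T := T) (i := i) g 0 0 v w
      rw [if_pos rfl, add_zero] at this
      exact this
    · change S.b v * S.a w = _
      rw [ha, hb]
      have := rep_plus_law (p := p) (T := T) (i := i) g 1 0 v w
      rw [if_neg (by decide), add_zero] at this
      exact this
  · rintro (⟨v, w⟩ | ⟨v, w⟩)
    · change S.b v * S.b w = _
      rw [hb, hb]
      have := rep_plus_law (p := p) (T := T) (i := i) g 0 1 v w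
      rw [if_pos rfl, zero_add] at this
      exact this
    · change S.a v * S.b w = _
      rw [ha, hb]
      have := rep_plus_law (p := p) (T := T) (i := i) g 1 1 v w
      rw [if_neg (by decide), h11] at this
      exact this

lemma rep_desc (p : Ω → ℝ) (hp : IsPMF p) (T : Ω → ZMod 2) (V : Ω → 𝒱) (n : ℕ) :
    ∀ i < 2 ^ n, Rep p T V n i (BS.desc (src p hp T V) n i) := by
  induction n with
  | zero =>
    intro i hi
    have : i = 0 := by simpa using hi
    subst this
    exact rep_zero p hp T V
  | succ n ih =>
    intro i hi
    have hh := ih (i / 2) (by rw [pow_succ] at hi; omega)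
    by_cases he : i % 2 = 0
    · have h1 := rep_minus hh
      rw [show 2 * (i / 2) = i by omega] at h1
      simpa [BS.desc, he] using h1
    · have h1 := rep_plus hh
      rw [show 2 * (i / 2) + 1 = i by omega] at h1
      simpa [BS.desc, he] using h1

/-- sums over values of random variables with the same kernel -/
lemma sum_ker {Ω A B : Type*} [Fintype A] [Fintype B] (X : Ω → A) (Y : Ω → B)
    (hk : ∀ ω ω', X ω = X ω' ↔ Y ω = Y ω') (F : A → ℝ) (G : B → ℝ)
    (hF : ∀ a, a ∉ Set.range X → F a = 0) (hG : ∀ b, b ∉ Set.range Y → G b = 0)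
    (hFG : ∀ ω, F (X ω) = G (Y ω)) : ∑ a, F a = ∑ b, G b := by
  rw [← Finset.sum_subset (Finset.subset_univ (Finset.univ.filter (· ∈ Set.range X)))
      (fun a _ ha => hF a (by simpa using ha)),
    ← Finset.sum_subset (Finset.subset_univ (Finset.univ.filter (· ∈ Set.range Y)))
      (fun a _ ha => hG a (by simpa using ha))]
  have hex : ∀ a ∈ Finset.univ.filter (· ∈ Set.range X), ∃ ω, X ω = a := by
    intro a ha; simpa using ha
  refine Finset.sum_bij (fun a ha => Y (hex a ha).choose) ?_ ?_ ?_ ?_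
  · intro a ha; simp
  · intro a ha b hb h
    rw [← hk, (hex a ha).choose_spec, (hex b hb).choose_spec] at h
    exact h
  · intro b hb
    obtain ⟨ω, rfl⟩ : ∃ ω, Y ω = b := by simpa using hb
    refine ⟨X ω, by simp, ?_⟩
    rw [← hk]
    exact (hex (X ω) (by simp)).choose_spec
  · intro a ha
    rw [← hFG, (hex a ha).choose_spec]

lemma dist_range {A : Type*} (p : Ω → ℝ) (X : Ω → A) (a : A) (h : a ∉ Set.range X) :
    dist p X a = 0 := by
  unfold dist
  apply Finset.sum_eq_zero
  intro ω _
  rw [if_neg]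
  intro h'; exact h ⟨ω, h'⟩

lemma dist_ker {A B : Type*} (p : Ω → ℝ) (X : Ω → A) (Y : Ω → B)
    (hk : ∀ ω ω', X ω = X ω' ↔ Y ω = Y ω') (ω : Ω) : dist p X (X ω) = dist p Y (Y ω) := by
  unfold dist
  simp only [hk]

lemma H_congr {A B : Type*} [Fintype A] [Fintype B] (p : Ω → ℝ) (X : Ω → A) (Y : Ω → B)
    (hk : ∀ ω ω', X ω = X ω' ↔ Y ω = Y ω') : H p X = H p Y := by
  unfold H
  refine sum_ker X Y hk _ _ ?_ ?_ ?_
  · intro a ha; rw [dist_range p X a ha]; simp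
  · intro a ha; rw [dist_range p Y a ha]; simp
  · intro ω; rw [dist_ker p X Y hk]

lemma ZB_desc {Ω' 𝒱' : Type*} [Fintype Ω'] [Fintype 𝒱'] (p : Ω → ℝ) (hp : IsPMF p)
    (T : Ω → ZMod 2) (V : Ω → 𝒱) (n i : ℕ) (hi : i < 2 ^ n)
    (e : Ω' ≃ (Fin (2 ^ n) → Ω)) (p' : Ω' → ℝ) (T' : Ω' → ZMod 2) (V' : Ω' → 𝒱')
    (hp' : ∀ ω, p' ω = iid p n (e ω)) (hT' : ∀ ω, T' ω = Un T n (e ω) i)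
    (hV' : ∀ ω ω', V' ω = V' ω' ↔ (∀ j < i, Un T n (e ω) j = Un T n (e ω') j) ∧
      ∀ j, V (e ω j) = V (e ω' j)) :
    ZB p' T' V' = (BS.desc (src p hp T V) n i).z := by
  obtain ⟨g, hg, ha, hb⟩ := rep_desc p hp T V n i hi
  have hk : ∀ ω ω', V' ω = V' ω' ↔ g (e ω) = g (e ω') := by
    intro ω ω'; rw [hV', hg]
  have hd : ∀ t ω, dist p' (fun ω => (T' ω, V' ω)) (t, V' ω) =
      dist (iid p n) (fun ω => (Un T n ω i, g ω)) (t, g (e ω)) := by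
    intro t ω
    unfold dist
    rw [← e.sum_comp]
    refine Finset.sum_congr rfl fun ω' _ => ?_
    simp only [Prod.mk.injEq, hT', hp', hk]
  unfold ZB BS.z BS.fn BS.zf
  rw [← Finset.mul_sum]
  congr 1
  refine sum_ker V' (fun ω => g (e ω)) hk _ _ ?_ ?_ ?_
  · intro v hv
    rw [dist_range]
    · simp
    · rintro ⟨ω, h⟩
      exact hv ⟨ω, (Prod.mk.inj h).2⟩
  · intro v hv
    rw [ha, dist_range]
    · simp
    · rintro ⟨ω, h⟩
      exact hv ⟨e.symm ω, by simpa using (Prod.mk.inj h).2⟩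
  · intro ω
    rw [hd, hd, ha, hb]

end Link


lemma ncard_eq {q N : ℕ} (P : Fin q → Fin N → Prop) :
    (({a | P a.1 a.2} : Set (Fin q × Fin N)).ncard : ℝ) =
      ∑ l, ∑ i, if P l i then (1 : ℝ) else 0 := by
  rw [Set.ncard_eq_toFinset_card', ← Fintype.sum_prod_type' (fun l i => if P l i then (1 : ℝ) else 0),
    Finset.sum_boole]
  congr 2
  ext a
  simp

lemma chain {Ω : Type*} {𝒴 : Type*} [Fintype Ω] [Fintype 𝒴] (p : Ω → ℝ)
    {q : ℕ} (b : Ω → Fin q → ZMod 2) (Y : Ω → 𝒴) :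
    ∑ l : Fin q, condH p (fun ω => b ω l) (fun ω => ((fun k : {k : Fin q // k < l} => b ω k), Y ω)) =
      H p (fun ω => (b ω, Y ω)) - H p Y := by
  let E : ℕ → ℝ := fun m => H p (fun ω => ((fun k : {k : Fin q // k.val < m} => b ω k), Y ω))
  have h1 : ∀ l : Fin q, condH p (fun ω => b ω l)
      (fun ω => ((fun k : {k : Fin q // k < l} => b ω k), Y ω)) = E (l.val + 1) - E l.val := by
    intro l
    unfold condH
    congr 1
    apply H_congr
    intro ω ω'
    simp only [Prod.mk.injEq, funext_iff, Subtype.forall]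
    constructor
    · rintro ⟨h1, h2, h3⟩
      refine ⟨fun k hk => ?_, h3⟩
      rcases (show k.val < l.val ∨ k.val = l.val by omega) with h | h
      · exact h2 k h
      · rw [Fin.ext h]; exact h1
    · rintro ⟨h1, h3⟩
      exact ⟨h1 l (by omega), fun k hk => h1 k (by have : k.val < l.val := hk; omega), h3⟩
  rw [Finset.sum_congr rfl fun l _ => h1 l,
    Fin.sum_univ_eq_sum_range (fun m => E (m + 1) - E m) q, Finset.sum_range_sub]
  congr 1
  · apply H_congr
    intro ω ω'
    simp only [Prod.mk.injEq, funext_iff, Subtype.forall]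
    exact and_congr_left fun _ => ⟨fun h k => h k k.2, fun h k _ => h k⟩
  · apply H_congr
    intro ω ω'
    simp only [Prod.mk.injEq, funext_iff, Subtype.forall]
    exact ⟨fun h => h.2, fun h => ⟨fun k hk => by omega, h⟩⟩

lemma level_main {Ω : Type*} {𝒴 : Type u} [Fintype Ω] [Fintype 𝒴] (p : Ω → ℝ) (hp : IsPMF p)
    {q : ℕ} (b : Ω → Fin q → ZMod 2) (Y : Ω → 𝒴) (Z : ∀ n : ℕ, Fin q → Fin (2 ^ n) → ℝ)
    (hZ : ∀ n l i, Z n l i = (BS.desc (src p hp (fun ω => b ω l)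
      (fun ω => ((fun k : {k : Fin q // k < l} => b ω k), Y ω))) n i.val).z)
    (β : ℝ) (hβ0 : 0 < β) (hβ : β < 1 / 2) :
    Tendsto (fun n : ℕ => (({a | Z n a.1 a.2 < deltaN β n} :
        Set (Fin q × Fin (2 ^ n))).ncard : ℝ) / 2 ^ n) atTop
        (𝓝 ((q : ℝ) - (H p (fun ω => (b ω, Y ω)) - H p Y))) ∧
    Tendsto (fun n : ℕ => (({a | 1 - deltaN β n < Z n a.1 a.2} :
        Set (Fin q × Fin (2 ^ n))).ncard : ℝ) / 2 ^ n) atTop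
        (𝓝 (H p (fun ω => (b ω, Y ω)) - H p Y)) := by
  let S : Fin q → BS.{u} := fun l => src p hp (fun ω => b ω l)
      (fun ω => ((fun k : {k : Fin q // k < l} => b ω k), Y ω))
  have hsum : ∑ l, (S l).h = H p (fun ω => (b ω, Y ω)) - H p Y := by
    rw [← chain]
    exact Finset.sum_congr rfl fun l _ => src_h _ _ _ _
  rw [← hsum]
  constructor
  · have h := tendsto_finsetSum (Finset.univ : Finset (Fin q))
      (fun l _ => BS.L_tendsto hβ0 hβ (S l))
    rw [Finset.sum_sub_distrib] at h
    simp only [Finset.sum_const, Finset.card_univ, Fintype.card_fin, nsmul_eq_mul, mul_one] at h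
    refine h.congr fun n => ?_
    rw [ncard_eq (fun l i => Z n l i < deltaN β n), Finset.sum_div]
    refine Finset.sum_congr rfl fun l _ => ?_
    rw [BS.av_eq_sum, ← Fin.sum_univ_eq_sum_range (fun i => if (BS.desc (S l) n i).z < deltaN β n then (1 : ℝ) else 0)]
    congr 1
    exact Finset.sum_congr rfl fun i _ => by rw [hZ]
  · have h := tendsto_finsetSum (Finset.univ : Finset (Fin q))
      (fun l _ => BS.H_tendsto hβ0 hβ (S l))
    refine h.congr fun n => ?_
    rw [ncard_eq (fun l i => 1 - deltaN β n < Z n l i), Finset.sum_div]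
    refine Finset.sum_congr rfl fun l _ => ?_
    rw [BS.av_eq_sum, ← Fin.sum_univ_eq_sum_range (fun i => if 1 - deltaN β n < (BS.desc (S l) n i).z then (1 : ℝ) else 0)]
    congr 1
    exact Finset.sum_congr rfl fun i _ => by rw [hZ]

lemma slP_pmf {𝒳 𝒴 : Type*} [Fintype 𝒳] [Fintype 𝒴] {PX : 𝒳 → ℝ} (hPX : IsPMF PX)
    {W : 𝒳 → 𝒴 → ℝ} (hW : IsChannel W) : IsPMF (slP PX W) := by
  refine ⟨fun a => mul_nonneg (hPX.1 _) (hW.1 _ _), ?_⟩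
  unfold slP
  rw [Fintype.sum_prod_type]
  simp only [← Finset.mul_sum, hW.2, mul_one]
  exact hPX.2

lemma Vval_eq {𝒳 : Type*} {q : ℕ} (f : (Fin q → ZMod 2) ≃ 𝒳) (n : ℕ) (x x' : Fin (2 ^ n) → 𝒳)
    (l : Fin q) (i : Fin (2 ^ n)) : Vval f n x l i = Vval f n x' l i ↔
      (∀ j < i, Ubit f n x l j = Ubit f n x' l j) ∧
      ∀ j, ∀ k < l, f.symm (x j) k = f.symm (x' j) k := by
  unfold Vval Bbit
  simp only [Prod.mk.injEq, funext_iff, Subtype.forall]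

lemma forall_fin_lt {N : ℕ} (i : Fin N) (P : ℕ → Prop) :
    (∀ j < i, P j.val) ↔ ∀ j < i.val, P j :=
  ⟨fun h j hj => h ⟨j, by omega⟩ hj, fun h j hj => h j.val hj⟩

lemma ZBplain_eq {𝒳 : Type*} [Fintype 𝒳] {q : ℕ} (f : (Fin q → ZMod 2) ≃ 𝒳) (PX : 𝒳 → ℝ)
    (hPX : IsPMF PX) (n : ℕ) (l : Fin q) (i : Fin (2 ^ n)) :
    ZBplain PX f n l i = (BS.desc (src PX hPX (fun x => f.symm x l)
      (fun x => ((fun k : {k : Fin q // k < l} => f.symm x k), ()))) n i.val).z := by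
  unfold ZBplain
  refine ZB_desc PX hPX _ _ n i.val i.2 (Equiv.refl _) _ _ _ (fun _ => rfl) (fun _ => rfl) ?_
  intro x x'
  rw [Vval_eq]
  refine and_congr (forall_fin_lt i (fun j => Un (fun x => f.symm x l) n x j =
    Un (fun x => f.symm x l) n x' j)) ?_
  simp [Prod.mk.injEq, funext_iff, Subtype.forall]

lemma ZBout_eq {𝒳 𝒴 : Type*} [Fintype 𝒳] [Fintype 𝒴] {q : ℕ} (f : (Fin q → ZMod 2) ≃ 𝒳)
    (PX : 𝒳 → ℝ) (W : 𝒳 → 𝒴 → ℝ) (hp : IsPMF (slP PX W)) (n : ℕ) (l : Fin q) (i : Fin (2 ^ n)) :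
    ZBout PX W f n l i = (BS.desc (src (slP PX W) hp (fun ω => f.symm ω.1 l)
      (fun ω => ((fun k : {k : Fin q // k < l} => f.symm ω.1 k), ω.2))) n i.val).z := by
  unfold ZBout
  refine ZB_desc (slP PX W) hp _ _ n i.val i.2
    (Equiv.arrowProdEquivProdArrow _ _ _).symm _ _ _ ?_ (fun _ => rfl) ?_
  · intro ω
    exact Finset.prod_mul_distrib.symm
  intro ω ω'
  rw [Prod.mk.injEq, Vval_eq, and_assoc]
  refine and_congr (forall_fin_lt i (fun j => Un (fun x => f.symm x l) n ω.1 j =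
    Un (fun x => f.symm x l) n ω'.1 j)) ?_
  simp [Prod.mk.injEq, funext_iff, Subtype.forall, forall_and, Equiv.arrowProdEquivProdArrow]

lemma H_unit {Ω : Type*} [Fintype Ω] (p : Ω → ℝ) (hp : IsPMF p) :
    H p (fun _ => ()) = 0 := by
  unfold H dist
  simp [hp.2]


/-- **(Proposition 1) Multilevel polarization.**
Let `W : 𝒳 → 𝒴` be a DMC with finite input alphabet of cardinality `2^q`,
labeled by the bijection `f`, with fixed input distribution `P_X`, in the
multilevel polar construction with block length `N = 2^n`.  Then, as `n → ∞`,
`q − lim |𝓛_X|/N = lim |𝓗_X|/N = H(X)` and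
`q − lim |𝓛_{X|Y}|/N = lim |𝓗_{X|Y}|/N = H(X|Y)`,
where `(X, Y) ∼ P_X(x)·W(y|x)` (entropies in bits). -/
theorem multilevel_polarization {𝒳 𝒴 : Type*} [Fintype 𝒳] [Fintype 𝒴] {q : ℕ}
    (f : (Fin q → ZMod 2) ≃ 𝒳) (PX : 𝒳 → ℝ) (hPX : IsPMF PX)
    (W : 𝒳 → 𝒴 → ℝ) (hW : IsChannel W)
    (β : ℝ) (hβ0 : 0 < β) (hβ : β < 1 / 2) :
    Tendsto (fun n : ℕ => ((Lplain PX f β n).ncard : ℝ) / 2 ^ n) atTop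
        (𝓝 ((q : ℝ) - H PX (id : 𝒳 → 𝒳))) ∧
    Tendsto (fun n : ℕ => ((Hplain PX f β n).ncard : ℝ) / 2 ^ n) atTop
        (𝓝 (H PX (id : 𝒳 → 𝒳))) ∧
    Tendsto (fun n : ℕ => ((Lout PX W f β n).ncard : ℝ) / 2 ^ n) atTop
        (𝓝 ((q : ℝ) - condH (slP PX W) Prod.fst Prod.snd)) ∧
    Tendsto (fun n : ℕ => ((Hout PX W f β n).ncard : ℝ) / 2 ^ n) atTop
        (𝓝 (condH (slP PX W) Prod.fst Prod.snd)) := by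
  have hp := slP_pmf hPX hW
  have h1 := level_main PX hPX (fun x => f.symm x) (fun _ => ()) (fun n l i => ZBplain PX f n l i)
    (fun n l i => ZBplain_eq f PX hPX n l i) β hβ0 hβ
  have h2 := level_main (slP PX W) hp (fun ω => f.symm ω.1) (fun ω => ω.2)
    (fun n l i => ZBout PX W f n l i) (fun n l i => ZBout_eq f PX W hp n l i) β hβ0 hβ
  have e1 : H PX (fun x => (f.symm x, ())) - H PX (fun _ => ()) = H PX (id : 𝒳 → 𝒳) := by
    rw [H_unit PX hPX, sub_zero]
    exact H_congr _ _ _ fun x x' => by simp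
  have e2 : H (slP PX W) (fun ω => (f.symm ω.1, ω.2)) - H (slP PX W) (fun ω => ω.2) =
      condH (slP PX W) Prod.fst Prod.snd := by
    unfold condH
    congr 1
    exact H_congr _ _ _ fun x x' => by simp [Prod.ext_iff]
  rw [e1] at h1
  rw [e2] at h2
  exact ⟨h1.1, h1.2, h2.1, h2.2⟩

end PolarWiretap

end
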